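/- Let Ω ⊂ ℝⁿ be a bounded domain with C^{4,α}-smooth boundary and let L be the elliptic operator with coefficients a_{ij}, b_i ∈ C^{2,α}(Ω̄), c ∈ C^{0,α}(Ω̄). Then there exists a continuous linear embedding E of the space {u ∈ C^{2,α}(Ω̄) : u = 0 and Lu = 0 on ∂Ω} into C_c^{2,α}(ℝⁿ) such that Eu = u on Ω and ‖Eu‖_{C⁰(ℝⁿ)} = ‖u‖_{C⁰(Ω̄)} for every u; i.e. the extension operator is a sup-norm contraction (in fact an isometry in sup-norm). -/

import Mathlib

open scoped NNReal Topology
open Set Metric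

noncomputable section

/-- Partial derivative within a set `s`, in coordinate direction `i`. -/
def pdW {n : ℕ} (s : Set (EuclideanSpace ℝ (Fin n))) (i : Fin n)
    (u : EuclideanSpace ℝ (Fin n) → ℝ) (x : EuclideanSpace ℝ (Fin n)) : ℝ :=
  fderivWithin ℝ u s x (EuclideanSpace.single i 1)

/-- The second-order elliptic operator `Lu = Σ aᵢⱼ ∂ᵢ∂ⱼ u + Σ bᵢ ∂ᵢ u + c·u`,
with derivatives taken within `s`. -/
def LopW {n : ℕ} (s : Set (EuclideanSpace ℝ (Fin n)))
    (a : Fin n → Fin n → EuclideanSpace ℝ (Fin n) → ℝ)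
    (b : Fin n → EuclideanSpace ℝ (Fin n) → ℝ)
    (c : EuclideanSpace ℝ (Fin n) → ℝ)
    (u : EuclideanSpace ℝ (Fin n) → ℝ) (x : EuclideanSpace ℝ (Fin n)) : ℝ :=
  (∑ i, ∑ j, a i j x * pdW s i (pdW s j u) x) + (∑ i, b i x * pdW s i u x) + c x * u x

/-- `f ∈ C^{0,α}(s)`: `f` is `α`-Hölder continuous on `s`. -/
def MemC0α {n : ℕ} (α : ℝ≥0) (f : EuclideanSpace ℝ (Fin n) → ℝ)
    (s : Set (EuclideanSpace ℝ (Fin n))) : Prop :=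
  ∃ C : ℝ≥0, HolderOnWith C α f s

/-- `u ∈ C^{2,α}(s)`: `u` is twice continuously differentiable on `s` and its second
derivative is `α`-Hölder continuous on `s`. -/
def MemC2α {n : ℕ} (α : ℝ≥0) (u : EuclideanSpace ℝ (Fin n) → ℝ)
    (s : Set (EuclideanSpace ℝ (Fin n))) : Prop :=
  ContDiffOn ℝ 2 u s ∧ ∃ C : ℝ≥0, HolderOnWith C α (iteratedFDerivWithin ℝ 2 u s) s

/-- Uniform ellipticity of the coefficient matrix `(aᵢⱼ)` on `s` with constant `lam`. -/
def UnifElliptic {n : ℕ} (a : Fin n → Fin n → EuclideanSpace ℝ (Fin n) → ℝ) (lam : ℝ)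
    (s : Set (EuclideanSpace ℝ (Fin n))) : Prop :=
  ∀ x ∈ s, ∀ ξ : EuclideanSpace ℝ (Fin n), lam * ‖ξ‖ ^ 2 ≤ ∑ i, ∑ j, a i j x * ξ i * ξ j

/-- All coefficients are bounded by `Λ` on `s`. -/
def CoeffBound {n : ℕ} (a : Fin n → Fin n → EuclideanSpace ℝ (Fin n) → ℝ)
    (b : Fin n → EuclideanSpace ℝ (Fin n) → ℝ)
    (c : EuclideanSpace ℝ (Fin n) → ℝ) (Lam : ℝ)
    (s : Set (EuclideanSpace ℝ (Fin n))) : Prop :=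
  ∀ x ∈ s, (∀ i j, |a i j x| ≤ Lam) ∧ (∀ i, |b i x| ≤ Lam) ∧ |c x| ≤ Lam

/-- Supremum norm of `u` over the set `s`. -/
def supNormOn {n : ℕ} (u : EuclideanSpace ℝ (Fin n) → ℝ)
    (s : Set (EuclideanSpace ℝ (Fin n))) : ℝ :=
  sSup ((fun x => |u x|) '' s)

/-- The boundary of `Ω` is `C^{k,α}`-smooth: near each boundary point it can be
flattened by a `C^{k,α}`-diffeomorphism `Ψ` (with `C^{k,α}` inverse `Φ`) mapping `Ω` to
one side of a coordinate hyperplane and `∂Ω` into the hyperplane. -/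
def SmoothBoundary {n : ℕ} (k : ℕ) (α : ℝ≥0) (Ω : Set (EuclideanSpace ℝ (Fin n))) : Prop :=
  ∀ z ∈ frontier Ω,
    ∃ (U V : Set (EuclideanSpace ℝ (Fin n)))
      (Ψ Φ : EuclideanSpace ℝ (Fin n) → EuclideanSpace ℝ (Fin n)) (i₀ : Fin n),
      IsOpen U ∧ IsOpen V ∧ z ∈ U ∧
      (∀ x ∈ U, Ψ x ∈ V) ∧ (∀ y ∈ V, Φ y ∈ U) ∧
      (∀ x ∈ U, Φ (Ψ x) = x) ∧ (∀ y ∈ V, Ψ (Φ y) = y) ∧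
      ContDiffOn ℝ k Ψ U ∧
      (∃ C : ℝ≥0, HolderOnWith C α (iteratedFDerivWithin ℝ k Ψ U) U) ∧
      ContDiffOn ℝ k Φ V ∧
      (∃ C : ℝ≥0, HolderOnWith C α (iteratedFDerivWithin ℝ k Φ V) V) ∧
      (∀ x ∈ U, (x ∈ Ω ↔ 0 < Ψ x i₀)) ∧
      (∀ x ∈ U, (x ∈ frontier Ω ↔ Ψ x i₀ = 0))

/-- Membership in `D(L) = {u ∈ C^{2,α}(Ω̄) ∣ u = 0, Lu = 0 on ∂Ω}`. -/
def MemDL {n : ℕ} (Ω : Set (EuclideanSpace ℝ (Fin n))) (α : ℝ≥0)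
    (a : Fin n → Fin n → EuclideanSpace ℝ (Fin n) → ℝ)
    (b : Fin n → EuclideanSpace ℝ (Fin n) → ℝ)
    (c : EuclideanSpace ℝ (Fin n) → ℝ)
    (u : EuclideanSpace ℝ (Fin n) → ℝ) : Prop :=
  MemC2α α u (closure Ω) ∧
  (∀ x ∈ frontier Ω, u x = 0) ∧
  (∀ x ∈ frontier Ω, LopW (closure Ω) a b c u x = 0)

/-- The Banach space `C_0^0(Ω̄)` of continuous functions on `Ω̄` vanishing on `∂Ω`,
with the supremum norm. -/
def C00 {n : ℕ} (Ω : Set (EuclideanSpace ℝ (Fin n))) [CompactSpace (closure Ω)] :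
    Submodule ℝ C(closure Ω, ℝ) where
  carrier := {u | ∀ x : closure Ω, (x : EuclideanSpace ℝ (Fin n)) ∈ frontier Ω → u x = 0}
  add_mem' := by
    intro u v hu hv x hx
    simp [ContinuousMap.add_apply, hu x hx, hv x hx]
  zero_mem' := by intro x hx; simp
  smul_mem' := by
    intro r u hu x hx
    simp [ContinuousMap.smul_apply, hu x hx]

section TwiceDifferentiable

set_option maxSynthPendingDepth 3

variable {E F G : Type*} [NormedAddCommGroup E] [NormedSpace ℝ E]
  [NormedAddCommGroup F] [NormedSpace ℝ F] [NormedAddCommGroup G] [NormedSpace ℝ G]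

/-- `f'` and `f''` are the first and second derivatives of `f` within `s`. -/
structure HasTwoFDerivsOn (s : Set E) (f : E → F) (f' : E → E →L[ℝ] F)
    (f'' : E → E →L[ℝ] E →L[ℝ] F) : Prop where
  fst : ∀ x ∈ s, HasFDerivWithinAt f (f' x) s x
  snd : ∀ x ∈ s, HasFDerivWithinAt f' (f'' x) s x

/-- `f` has derivatives `f'`, `f''` within `s`; all three are bounded by `M`, and `M` is also an
`α`-Hölder constant of `f''`. -/
structure C2HolderOn (α : ℝ) (s : Set E) (f : E → F) (f' : E → E →L[ℝ] F)
    (f'' : E → E →L[ℝ] E →L[ℝ] F) (M : ℝ) : Prop extends HasTwoFDerivsOn s f f' f'' where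
  bound : ∀ x ∈ s, ‖f x‖ ≤ M
  bound_fst : ∀ x ∈ s, ‖f' x‖ ≤ M
  bound_snd : ∀ x ∈ s, ‖f'' x‖ ≤ M
  holder : ∀ x ∈ s, ∀ y ∈ s, ‖f'' x - f'' y‖ ≤ M * ‖x - y‖ ^ α

/-- The second derivative of a composition, in terms of the derivatives of the factors. -/
def compSndDeriv (g' : F →L[ℝ] G) (g'' : F →L[ℝ] F →L[ℝ] G) (f' : E →L[ℝ] F)
    (f'' : E →L[ℝ] E →L[ℝ] F) : E →L[ℝ] E →L[ℝ] G :=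
  ContinuousLinearMap.compL ℝ E F G g' ∘L f'' +
    (ContinuousLinearMap.compL ℝ E F G).flip f' ∘L (g'' ∘L f')

theorem compSndDeriv_apply (g' : F →L[ℝ] G) (g'' : F →L[ℝ] F →L[ℝ] G) (f' : E →L[ℝ] F)
    (f'' : E →L[ℝ] E →L[ℝ] F) (h k : E) :
    compSndDeriv g' g'' f' f'' h k = g' (f'' h k) + g'' (f' h) (f' k) := rfl

theorem norm_compSndDeriv_le (g' : F →L[ℝ] G) (g'' : F →L[ℝ] F →L[ℝ] G) (f' : E →L[ℝ] F)
    (f'' : E →L[ℝ] E →L[ℝ] F) :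
    ‖compSndDeriv g' g'' f' f''‖ ≤ ‖g'‖ * ‖f''‖ + ‖g''‖ * (‖f'‖ * ‖f'‖) := by
  refine ContinuousLinearMap.opNorm_le_bound₂ _ (by positivity) fun h k => ?_
  rw [compSndDeriv_apply]
  have h1 : ‖g' (f'' h k)‖ ≤ ‖g'‖ * (‖f''‖ * ‖h‖ * ‖k‖) :=
    g'.le_opNorm_of_le (f''.le_opNorm₂ h k)
  have h2 : ‖g'' (f' h) (f' k)‖ ≤ ‖g''‖ * (‖f'‖ * ‖h‖) * (‖f'‖ * ‖k‖) :=
    g''.le_of_opNorm₂_le_of_le le_rfl (f'.le_opNorm h) (f'.le_opNorm k)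
  calc _ ≤ _ := norm_add_le _ _
    _ ≤ _ := add_le_add h1 h2
    _ = _ := by ring

theorem norm_compSndDeriv_sub_le (g₁' g₂' : F →L[ℝ] G) (g₁'' g₂'' : F →L[ℝ] F →L[ℝ] G)
    (f₁' f₂' : E →L[ℝ] F) (f₁'' f₂'' : E →L[ℝ] E →L[ℝ] F) :
    ‖compSndDeriv g₁' g₁'' f₁' f₁'' - compSndDeriv g₂' g₂'' f₂' f₂''‖ ≤
      ‖g₁' - g₂'‖ * ‖f₁''‖ + ‖g₂'‖ * ‖f₁'' - f₂''‖ + ‖g₁'' - g₂''‖ * (‖f₁'‖ * ‖f₁'‖)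
        + ‖g₂''‖ * (‖f₁' - f₂'‖ * ‖f₁'‖) + ‖g₂''‖ * (‖f₂'‖ * ‖f₁' - f₂'‖) := by
  refine ContinuousLinearMap.opNorm_le_bound₂ _ (by positivity) fun h k => ?_
  have e : (compSndDeriv g₁' g₁'' f₁' f₁'' - compSndDeriv g₂' g₂'' f₂' f₂'') h k =
      (g₁' - g₂') (f₁'' h k) + g₂' ((f₁'' - f₂'') h k) + (g₁'' - g₂'') (f₁' h) (f₁' k)
        + g₂'' ((f₁' - f₂') h) (f₁' k) + g₂'' (f₂' h) ((f₁' - f₂') k) := by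
    simp only [sub_apply, compSndDeriv_apply, map_sub]
    abel
  rw [e]
  have h1 : ‖(g₁' - g₂') (f₁'' h k)‖ ≤ ‖g₁' - g₂'‖ * (‖f₁''‖ * ‖h‖ * ‖k‖) :=
    (g₁' - g₂').le_opNorm_of_le (f₁''.le_opNorm₂ h k)
  have h2 : ‖g₂' ((f₁'' - f₂'') h k)‖ ≤ ‖g₂'‖ * (‖f₁'' - f₂''‖ * ‖h‖ * ‖k‖) :=
    g₂'.le_opNorm_of_le ((f₁'' - f₂'').le_opNorm₂ h k)
  have h3 : ‖(g₁'' - g₂'') (f₁' h) (f₁' k)‖ ≤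
      ‖g₁'' - g₂''‖ * (‖f₁'‖ * ‖h‖) * (‖f₁'‖ * ‖k‖) :=
    (g₁'' - g₂'').le_of_opNorm₂_le_of_le le_rfl (f₁'.le_opNorm h) (f₁'.le_opNorm k)
  have h4 : ‖g₂'' ((f₁' - f₂') h) (f₁' k)‖ ≤ ‖g₂''‖ * (‖f₁' - f₂'‖ * ‖h‖) * (‖f₁'‖ * ‖k‖) :=
    g₂''.le_of_opNorm₂_le_of_le le_rfl ((f₁' - f₂').le_opNorm h) (f₁'.le_opNorm k)
  have h5 : ‖g₂'' (f₂' h) ((f₁' - f₂') k)‖ ≤ ‖g₂''‖ * (‖f₂'‖ * ‖h‖) * (‖f₁' - f₂'‖ * ‖k‖) :=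
    g₂''.le_of_opNorm₂_le_of_le le_rfl (f₂'.le_opNorm h) ((f₁' - f₂').le_opNorm k)
  calc _ ≤ _ := norm_add_le_of_le (norm_add_le_of_le (norm_add_le_of_le
        (norm_add_le_of_le h1 h2) h3) h4) h5
    _ = _ := by ring

namespace HasTwoFDerivsOn

variable {s t : Set E} {f : E → F} {f' : E → E →L[ℝ] F} {f'' : E → E →L[ℝ] E →L[ℝ] F}

theorem mono (hf : HasTwoFDerivsOn s f f' f'') (hts : t ⊆ s) : HasTwoFDerivsOn t f f' f'' :=
  ⟨fun x hx => (hf.fst x (hts hx)).mono hts, fun x hx => (hf.snd x (hts hx)).mono hts⟩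

theorem congr {g : E → F} (hf : HasTwoFDerivsOn s f f' f'') (h : EqOn g f s) :
    HasTwoFDerivsOn s g f' f'' :=
  ⟨fun x hx => (hf.fst x hx).congr h (h hx), hf.snd⟩

theorem comp {t : Set F} {g : F → G} {g' : F → F →L[ℝ] G} {g'' : F → F →L[ℝ] F →L[ℝ] G}
    (hg : HasTwoFDerivsOn t g g' g'') (hf : HasTwoFDerivsOn s f f' f'') (hst : MapsTo f s t) :
    HasTwoFDerivsOn s (g ∘ f) (fun x => g' (f x) ∘L f' x)
      (fun x => compSndDeriv (g' (f x)) (g'' (f x)) (f' x) (f'' x)) :=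
  ⟨fun x hx => (hg.fst _ (hst hx)).comp x (hf.fst x hx) hst,
    fun x hx => ((hg.snd _ (hst hx)).comp x (hf.fst x hx) hst).clm_comp (hf.snd x hx)⟩

theorem fst_unique {g' : E → E →L[ℝ] F} {g'' : E → E →L[ℝ] E →L[ℝ] F}
    (hf : HasTwoFDerivsOn s f f' f'') (hg : HasTwoFDerivsOn s f g' g'') (hs : UniqueDiffOn ℝ s) :
    EqOn f' g' s :=
  fun x hx => (hs x hx).eq (hf.fst x hx) (hg.fst x hx)

theorem snd_unique {g' : E → E →L[ℝ] F} {g'' : E → E →L[ℝ] E →L[ℝ] F}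
    (hf : HasTwoFDerivsOn s f f' f'') (hg : HasTwoFDerivsOn s f g' g'') (hs : UniqueDiffOn ℝ s) :
    EqOn f'' g'' s :=
  fun x hx => (hs x hx).eq (hf.snd x hx)
    ((hg.snd x hx).congr (hf.fst_unique hg hs) (hf.fst_unique hg hs hx))

theorem symmetric (hf : HasTwoFDerivsOn s f f' f'') (hs : Convex ℝ s)
    (hne : (interior s).Nonempty) {x : E} (hx : x ∈ s) (h k : E) : f'' x h k = f'' x k h :=
  hs.second_derivative_within_at_symmetric hne
    (fun y hy => (hf.fst y (interior_subset hy)).hasFDerivAt (mem_interior_iff_mem_nhds.1 hy)) hx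
    ((hf.snd x hx).mono interior_subset) h k

end HasTwoFDerivsOn

theorem le_rpow_of_le_one' {a α : ℝ} (ha : 0 ≤ a) (ha1 : a ≤ 1) (hα : α ≤ 1) : a ≤ a ^ α := by
  rcases ha.eq_or_lt with rfl | h
  · exact Real.rpow_nonneg le_rfl _
  · simpa using Real.rpow_le_rpow_of_exponent_ge h ha1 hα

namespace C2HolderOn

variable {α M N : ℝ} {s t : Set E} {f g : E → F} {f' g' : E → E →L[ℝ] F}
  {f'' g'' : E → E →L[ℝ] E →L[ℝ] F}

theorem mono (hf : C2HolderOn α s f f' f'' M) (hts : t ⊆ s) : C2HolderOn α t f f' f'' M :=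
  ⟨hf.toHasTwoFDerivsOn.mono hts, fun x hx => hf.bound x (hts hx),
    fun x hx => hf.bound_fst x (hts hx), fun x hx => hf.bound_snd x (hts hx),
    fun x hx y hy => hf.holder x (hts hx) y (hts hy)⟩

theorem mono_const (hf : C2HolderOn α s f f' f'' M) (hMN : M ≤ N) : C2HolderOn α s f f' f'' N :=
  ⟨hf.toHasTwoFDerivsOn, fun x hx => (hf.bound x hx).trans hMN,
    fun x hx => (hf.bound_fst x hx).trans hMN, fun x hx => (hf.bound_snd x hx).trans hMN,
    fun x hx y hy => (hf.holder x hx y hy).trans (by gcongr)⟩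

theorem congr (hf : C2HolderOn α s f f' f'' M) (h : EqOn g f s) : C2HolderOn α s g f' f'' M :=
  ⟨hf.toHasTwoFDerivsOn.congr h, fun x hx => (h hx).symm ▸ hf.bound x hx, hf.bound_fst,
    hf.bound_snd, hf.holder⟩

theorem add (hf : C2HolderOn α s f f' f'' M) (hg : C2HolderOn α s g g' g'' N) :
    C2HolderOn α s (f + g) (f' + g') (f'' + g'') (M + N) where
  fst x hx := (hf.fst x hx).add (hg.fst x hx)
  snd x hx := (hf.snd x hx).add (hg.snd x hx)
  bound x hx := norm_add_le_of_le (hf.bound x hx) (hg.bound x hx)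
  bound_fst x hx := norm_add_le_of_le (hf.bound_fst x hx) (hg.bound_fst x hx)
  bound_snd x hx := norm_add_le_of_le (hf.bound_snd x hx) (hg.bound_snd x hx)
  holder x hx y hy := by
    rw [Pi.add_apply, Pi.add_apply, add_sub_add_comm, add_mul]
    exact norm_add_le_of_le (hf.holder x hx y hy) (hg.holder x hx y hy)

theorem zero : C2HolderOn α s (0 : E → F) 0 0 0 where
  fst x _ := hasFDerivWithinAt_const 0 x s
  snd x _ := hasFDerivWithinAt_const 0 x s
  bound x _ := by simp
  bound_fst x _ := by simp
  bound_snd x _ := by simp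
  holder x _ y _ := by simp

theorem sum {ι : Type*} (I : Finset ι) {f : ι → E → F} {f' : ι → E → E →L[ℝ] F}
    {f'' : ι → E → E →L[ℝ] E →L[ℝ] F} {M : ι → ℝ}
    (h : ∀ i ∈ I, C2HolderOn α s (f i) (f' i) (f'' i) (M i)) :
    C2HolderOn α s (∑ i ∈ I, f i) (∑ i ∈ I, f' i) (∑ i ∈ I, f'' i) (∑ i ∈ I, M i) := by
  classical
  induction I using Finset.induction_on with
  | empty => simpa using zero
  | insert i I hi ih =>
    simp only [Finset.sum_insert hi]
    exact (h i (Finset.mem_insert_self i I)).add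
      (ih fun j hj => h j (Finset.mem_insert_of_mem hj))

theorem neg (hf : C2HolderOn α s f f' f'' M) : C2HolderOn α s (-f) (-f') (-f'') M where
  fst x hx := (hf.fst x hx).neg
  snd x hx := (hf.snd x hx).neg
  bound x hx := by simpa using hf.bound x hx
  bound_fst x hx := by simpa using hf.bound_fst x hx
  bound_snd x hx := by simpa using hf.bound_snd x hx
  holder x hx y hy := by
    rw [Pi.neg_apply, Pi.neg_apply, neg_sub_neg, norm_sub_rev (f'' y)]
    exact hf.holder x hx y hy

theorem lipschitz (hf : C2HolderOn α s f f' f'' M) (hs : Convex ℝ s) {x y : E} (hx : x ∈ s)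
    (hy : y ∈ s) : ‖f x - f y‖ ≤ M * ‖x - y‖ :=
  hs.norm_image_sub_le_of_norm_hasFDerivWithin_le hf.fst hf.bound_fst hy hx

theorem lipschitz_fst (hf : C2HolderOn α s f f' f'' M) (hs : Convex ℝ s) {x y : E} (hx : x ∈ s)
    (hy : y ∈ s) : ‖f' x - f' y‖ ≤ M * ‖x - y‖ :=
  hs.norm_image_sub_le_of_norm_hasFDerivWithin_le hf.snd hf.bound_snd hy hx

/-- A composition with a `C^{2,α}` map on a convex set of diameter at most one is bounded in
`C^{2,α}`, linearly in the bound on the outer function. -/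
theorem comp {t : Set F} {g : F → G} {g' : F → F →L[ℝ] G} {g'' : F → F →L[ℝ] F →L[ℝ] G}
    (hα0 : 0 < α) (hα1 : α ≤ 1) (hN : 1 ≤ N) (hM : 0 ≤ M) (hs : Convex ℝ s)
    (hd : ∀ x ∈ s, ∀ y ∈ s, ‖x - y‖ ≤ 1)
    (hg : C2HolderOn α t g g' g'' M) (hf : C2HolderOn α s f f' f'' N) (hst : MapsTo f s t) :
    C2HolderOn α s (g ∘ f) (fun x => g' (f x) ∘L f' x)
      (fun x => compSndDeriv (g' (f x)) (g'' (f x)) (f' x) (f'' x)) (5 * N ^ 3 * M) := by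
  have h2 := hg.toHasTwoFDerivsOn.comp hf.toHasTwoFDerivsOn hst
  have hN1 : N ≤ N ^ 2 := by nlinarith
  have hN2 : N ^ 2 ≤ N ^ 3 := by nlinarith [sq_nonneg N]
  have hMN : M ≤ M * N := le_mul_of_one_le_right hM hN
  have e1 : M * N ≤ M * N ^ 3 := by gcongr; linarith
  have e2 : M * N ^ 2 ≤ M * N ^ 3 := by gcongr
  have e0 : 0 ≤ M * N ^ 3 := by positivity
  have e3 : 5 * N ^ 3 * M = 5 * (M * N ^ 3) := by ring
  have key : ∀ x ∈ s, ∀ y ∈ s, ‖g' (f x) - g' (f y)‖ ≤ M * N * ‖x - y‖ := by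
    intro x hx y hy
    refine hs.norm_image_sub_le_of_norm_hasFDerivWithin_le (f := fun x => g' (f x))
      (fun z hz => (hg.snd _ (hst hz)).comp z (hf.fst z hz) hst) (fun z hz => ?_) hy hx
    exact (ContinuousLinearMap.opNorm_comp_le _ _).trans
      (mul_le_mul (hg.bound_snd _ (hst hz)) (hf.bound_fst z hz) (norm_nonneg _) hM)
  refine ⟨h2, fun x hx => ?_, fun x hx => ?_, fun x hx => ?_, fun x hx y hy => ?_⟩
  · have := hg.bound _ (hst hx)
    simp only [Function.comp_apply]
    linarith
  · refine (ContinuousLinearMap.opNorm_comp_le _ _).trans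
      ((mul_le_mul (hg.bound_fst _ (hst hx)) (hf.bound_fst x hx) (norm_nonneg _) hM).trans ?_)
    linarith
  · refine (norm_compSndDeriv_le _ _ _ _).trans ?_
    have b1 : ‖g' (f x)‖ * ‖f'' x‖ ≤ M * N :=
      mul_le_mul (hg.bound_fst _ (hst hx)) (hf.bound_snd x hx) (norm_nonneg _) hM
    have b2 : ‖g'' (f x)‖ * (‖f' x‖ * ‖f' x‖) ≤ M * (N * N) :=
      mul_le_mul (hg.bound_snd _ (hst hx)) (mul_le_mul (hf.bound_fst x hx) (hf.bound_fst x hx)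
        (norm_nonneg _) (by linarith)) (by positivity) hM
    nlinarith
  · refine (norm_compSndDeriv_sub_le _ _ _ _ _ _ _ _).trans ?_
    set a := ‖x - y‖ ^ α with ha
    have ha0 : 0 ≤ a := by positivity
    have hxy : ‖x - y‖ ≤ a := le_rpow_of_le_one' (norm_nonneg _) (hd x hx y hy) hα1
    have hN0 : (0 : ℝ) ≤ N := by linarith
    have c1 : ‖g' (f x) - g' (f y)‖ ≤ M * N * a :=
      (key x hx y hy).trans (by gcongr)
    have c2 : ‖f' x - f' y‖ ≤ N * a :=
      (hf.lipschitz_fst hs hx hy).trans (by gcongr)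
    have c3 : ‖g'' (f x) - g'' (f y)‖ ≤ M * (N * a) := by
      refine (hg.holder _ (hst hx) _ (hst hy)).trans ?_
      gcongr
      calc ‖f x - f y‖ ^ α ≤ (N * ‖x - y‖) ^ α := by
            gcongr
            exact hf.lipschitz hs hx hy
        _ = N ^ α * a := Real.mul_rpow hN0 (norm_nonneg _)
        _ ≤ N * a := by
            gcongr
            simpa using Real.rpow_le_rpow_of_exponent_le hN hα1
    have c4 : ‖f'' x - f'' y‖ ≤ N * a := hf.holder x hx y hy
    have d1 : ‖g' (f x) - g' (f y)‖ * ‖f'' x‖ ≤ M * N * a * N := by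
      gcongr; exact hf.bound_snd x hx
    have d2 : ‖g' (f y)‖ * ‖f'' x - f'' y‖ ≤ M * (N * a) := by
      gcongr; exact hg.bound_fst _ (hst hy)
    have d3 : ‖g'' (f x) - g'' (f y)‖ * (‖f' x‖ * ‖f' x‖) ≤ M * (N * a) * (N * N) := by
      gcongr <;> exact hf.bound_fst x hx
    have d4 : ‖g'' (f y)‖ * (‖f' x - f' y‖ * ‖f' x‖) ≤ M * (N * a * N) := by
      gcongr
      exacts [hg.bound_snd _ (hst hy), hf.bound_fst x hx]
    have d5 : ‖g'' (f y)‖ * (‖f' y‖ * ‖f' x - f' y‖) ≤ M * (N * (N * a)) := by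
      gcongr
      exacts [hg.bound_snd _ (hst hy), hf.bound_fst y hy]
    have f1 : M * N * a ≤ M * N ^ 3 * a := by gcongr
    have f2 : M * N ^ 2 * a ≤ M * N ^ 3 * a := by gcongr
    calc _ ≤ _ := add_le_add (add_le_add (add_le_add (add_le_add d1 d2) d3) d4) d5
      _ = M * N * a + 3 * (M * N ^ 2 * a) + M * N ^ 3 * a := by ring
      _ ≤ 5 * N ^ 3 * M * a := by linarith

end C2HolderOn

end TwiceDifferentiable

section Gluing

set_option maxSynthPendingDepth 3

variable {E F : Type*} [NormedAddCommGroup E] [NormedSpace ℝ E]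
  [NormedAddCommGroup F] [NormedSpace ℝ F]

theorem HasFDerivWithinAt.ite_halfSpace {B : Set E} {l : E →L[ℝ] ℝ} {f g : E → F}
    {f' g' : E → E →L[ℝ] F}
    (hf : ∀ x ∈ B ∩ {y | 0 ≤ l y}, HasFDerivWithinAt f (f' x) (B ∩ {y | 0 ≤ l y}) x)
    (hg : ∀ x ∈ B ∩ {y | l y ≤ 0}, HasFDerivWithinAt g (g' x) (B ∩ {y | l y ≤ 0}) x)
    (h0 : ∀ x ∈ B, l x = 0 → f x = g x) (h1 : ∀ x ∈ B, l x = 0 → f' x = g' x)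
    {x : E} (hx : x ∈ B) :
    HasFDerivWithinAt (fun y => if 0 ≤ l y then f y else g y)
      (if 0 ≤ l x then f' x else g' x) B x := by
  have hcover : B = (B ∩ {y | 0 ≤ l y}) ∪ (B ∩ {y | l y ≤ 0}) := by
    ext y
    simp only [mem_union, mem_inter_iff, mem_ofPred_eq]
    have := le_total 0 (l y)
    tauto
  have ef : ∀ y ∈ B ∩ {y | 0 ≤ l y}, (if 0 ≤ l y then f y else g y) = f y :=
    fun y hy => if_pos hy.2
  have eg : ∀ y ∈ B ∩ {y | l y ≤ 0}, (if 0 ≤ l y then f y else g y) = g y := by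
    intro y hy
    split_ifs with h
    · exact h0 y hy.1 (le_antisymm hy.2 h)
    · rfl
  rw [hcover]
  refine HasFDerivWithinAt.union ?_ ?_
  · by_cases h : 0 ≤ l x
    · rw [if_pos h]
      exact (hf x ⟨hx, h⟩).congr ef (ef x ⟨hx, h⟩)
    · refine HasFDerivWithinAt.of_notMem_closure fun hc => h ?_
      exact closure_minimal inter_subset_right (isClosed_le continuous_const l.continuous) hc
  · by_cases h : l x ≤ 0
    · have : (if 0 ≤ l x then f' x else g' x) = g' x := by
        split_ifs with h'
        · exact h1 x hx (le_antisymm h h')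
        · rfl
      rw [this]
      exact (hg x ⟨hx, h⟩).congr eg (eg x ⟨hx, h⟩)
    · refine HasFDerivWithinAt.of_notMem_closure fun hc => h ?_
      exact closure_minimal inter_subset_right (isClosed_le l.continuous continuous_const) hc

/-- Two functions that are `C^{2,α}` on the two sides of a hyperplane and agree on it to second
order glue to a `C^{2,α}` function. -/
theorem C2HolderOn.ite_halfSpace {α M : ℝ} (hα : 0 < α) (hM : 0 ≤ M) {B : Set E}
    (hB : Convex ℝ B) {l : E →L[ℝ] ℝ}
    {f g : E → F} {f' g' : E → E →L[ℝ] F} {f'' g'' : E → E →L[ℝ] E →L[ℝ] F}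
    (hf : C2HolderOn α (B ∩ {y | 0 ≤ l y}) f f' f'' M)
    (hg : C2HolderOn α (B ∩ {y | l y ≤ 0}) g g' g'' M)
    (h0 : ∀ x ∈ B, l x = 0 → f x = g x) (h1 : ∀ x ∈ B, l x = 0 → f' x = g' x)
    (h2 : ∀ x ∈ B, l x = 0 → f'' x = g'' x) :
    C2HolderOn α B (fun y => if 0 ≤ l y then f y else g y)
      (fun y => if 0 ≤ l y then f' y else g' y)
      (fun y => if 0 ≤ l y then f'' y else g'' y) (2 * M) := by
  have cross : ∀ x ∈ B, ∀ y ∈ B, 0 ≤ l x → l y < 0 →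
      ‖f'' x - g'' y‖ ≤ 2 * M * ‖x - y‖ ^ α := by
    intro x hx y hy hlx hly
    obtain ⟨t, ht0, ht1, ht⟩ : ∃ t : ℝ, 0 ≤ t ∧ t ≤ 1 ∧ l x + t * (l y - l x) = 0 :=
      ⟨l x / (l x - l y), div_nonneg hlx (by linarith),
        (div_le_one (by linarith)).2 (by linarith), by
          have : l x - l y ≠ 0 := by linarith
          field_simp
          ring⟩
    set m := x + t • (y - x) with hm
    have hmB : m ∈ B := hB.add_smul_sub_mem hx hy ⟨ht0, ht1⟩
    have hlm : l m = 0 := by simpa [hm] using ht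
    have n1 : ‖x - m‖ ≤ ‖x - y‖ := by
      have : x - m = t • (x - y) := by rw [hm]; module
      rw [this, norm_smul, Real.norm_of_nonneg ht0]
      exact mul_le_of_le_one_left (norm_nonneg _) ht1
    have n2 : ‖m - y‖ ≤ ‖x - y‖ := by
      have : m - y = (1 - t) • (x - y) := by rw [hm]; module
      rw [this, norm_smul, Real.norm_of_nonneg (by linarith)]
      exact mul_le_of_le_one_left (norm_nonneg _) (by linarith)
    have k1 := hf.holder x ⟨hx, hlx⟩ m ⟨hmB, hlm.ge⟩
    have k2 := hg.holder m ⟨hmB, hlm.le⟩ y ⟨hy, hly.le⟩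
    have k3 : M * ‖x - m‖ ^ α ≤ M * ‖x - y‖ ^ α := by gcongr
    have k4 : M * ‖m - y‖ ^ α ≤ M * ‖x - y‖ ^ α := by gcongr
    have e : f'' x - g'' y = (f'' x - f'' m) + (g'' m - g'' y) := by
      rw [h2 m hmB hlm]; abel
    rw [e]
    linarith [norm_add_le (f'' x - f'' m) (g'' m - g'' y)]
  refine ⟨⟨fun x hx => .ite_halfSpace hf.fst hg.fst h0 h1 hx,
    fun x hx => .ite_halfSpace hf.snd hg.snd h1 h2 hx⟩, fun x hx => ?_, fun x hx => ?_,
    fun x hx => ?_, fun x hx y hy => ?_⟩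
  · split_ifs with h
    · linarith [hf.bound x ⟨hx, h⟩]
    · linarith [hg.bound x ⟨hx, (not_le.1 h).le⟩]
  · split_ifs with h
    · linarith [hf.bound_fst x ⟨hx, h⟩]
    · linarith [hg.bound_fst x ⟨hx, (not_le.1 h).le⟩]
  · split_ifs with h
    · linarith [hf.bound_snd x ⟨hx, h⟩]
    · linarith [hg.bound_snd x ⟨hx, (not_le.1 h).le⟩]
  · have hnn : 0 ≤ M * ‖x - y‖ ^ α := by positivity
    split_ifs with h h' h'
    · linarith [hf.holder x ⟨hx, h⟩ y ⟨hy, h'⟩]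
    · exact cross x hx y hy h (not_le.1 h')
    · rw [norm_sub_rev, norm_sub_rev x y]
      exact cross y hy x hx h' (not_le.1 h)
    · linarith [hg.holder x ⟨hx, (not_le.1 h).le⟩ y ⟨hy, (not_le.1 h').le⟩]

/-- Functions that agree on a hyperplane have the same tangential derivatives there. -/
theorem HasFDerivWithinAt.apply_eq_of_eqOn_ker {B s t : Set E} {l : E →L[ℝ] ℝ} {f g : E → F}
    {f' g' : E →L[ℝ] F} {x : E} (hB : IsOpen B) (hf : HasFDerivWithinAt f f' s x)
    (hg : HasFDerivWithinAt g g' t x) (hs : B ∩ {y | l y = 0} ⊆ s) (ht : B ∩ {y | l y = 0} ⊆ t)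
    (hfg : EqOn f g (B ∩ {y | l y = 0})) (hx : x ∈ B) (hlx : l x = 0) {h : E} (hh : l h = 0) :
    f' h = g' h := by
  have hline : HasDerivAt (fun r : ℝ => x + r • h) h 0 := by
    simpa using ((hasDerivAt_id (0 : ℝ)).smul_const h).const_add x
  have hmem : ∀ᶠ r : ℝ in 𝓝 0, x + r • h ∈ B ∩ {y | l y = 0} := by
    have : ∀ᶠ r : ℝ in 𝓝 0, x + r • h ∈ B :=
      hline.continuousAt.preimage_mem_nhds (hB.mem_nhds (by simpa using hx))
    filter_upwards [this] with r hr
    exact ⟨hr, by simp [hlx, hh]⟩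
  have df := HasFDerivWithinAt.comp_hasDerivAt (0 : ℝ) (l := f) (t := B ∩ {y | l y = 0})
    (by simpa using hf.mono hs) hline hmem
  have dg := HasFDerivWithinAt.comp_hasDerivAt (0 : ℝ) (l := g) (t := B ∩ {y | l y = 0})
    (by simpa using hg.mono ht) hline hmem
  refine df.unique (dg.congr_of_eventuallyEq ?_)
  filter_upwards [hmem] with r hr using hfg hr

end Gluing

section Cutoff

set_option maxSynthPendingDepth 3

variable {E : Type*} [NormedAddCommGroup E] [NormedSpace ℝ E]

theorem norm_smul_sub_smul_le {F : Type*} [NormedAddCommGroup F] [NormedSpace ℝ F]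
    {c₁ c₂ : ℝ} {v₁ v₂ : F} {N M a : ℝ} (hc : |c₂| ≤ N) (hv : ‖v₁‖ ≤ M)
    (hcc : |c₁ - c₂| ≤ N * a) (hvv : ‖v₁ - v₂‖ ≤ M * a) :
    ‖c₁ • v₁ - c₂ • v₂‖ ≤ 2 * (N * M) * a := by
  have e : c₁ • v₁ - c₂ • v₂ = (c₁ - c₂) • v₁ + c₂ • (v₁ - v₂) := by module
  have hN : 0 ≤ N := (abs_nonneg _).trans hc
  have k1 : ‖(c₁ - c₂) • v₁‖ ≤ N * a * M := by
    rw [norm_smul]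
    exact mul_le_mul hcc hv (norm_nonneg _) ((abs_nonneg _).trans hcc)
  have k2 : ‖c₂ • (v₁ - v₂)‖ ≤ N * (M * a) := by
    rw [norm_smul]
    exact mul_le_mul hc hvv (norm_nonneg _) hN
  rw [e]
  linarith [norm_add_le ((c₁ - c₂) • v₁) (c₂ • (v₁ - v₂))]

theorem norm_smul_le_mul {F : Type*} [NormedAddCommGroup F] [NormedSpace ℝ F] {c : ℝ} {v : F}
    {N M : ℝ} (hc : |c| ≤ N) (hv : ‖v‖ ≤ M) : ‖c • v‖ ≤ N * M := by
  rw [norm_smul]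
  exact mul_le_mul hc hv (norm_nonneg _) ((abs_nonneg _).trans hc)

theorem norm_smulRight_sub_smulRight_le {F : Type*} [NormedAddCommGroup F] [NormedSpace ℝ F]
    {c₁ c₂ : E →L[ℝ] ℝ} {v₁ v₂ : F} {N M a : ℝ} (hc : ‖c₂‖ ≤ N) (hv : ‖v₁‖ ≤ M)
    (hcc : ‖c₁ - c₂‖ ≤ N * a) (hvv : ‖v₁ - v₂‖ ≤ M * a) :
    ‖c₁.smulRight v₁ - c₂.smulRight v₂‖ ≤ 2 * (N * M) * a := by
  have e : c₁.smulRight v₁ - c₂.smulRight v₂ =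
      (c₁ - c₂).smulRight v₁ + c₂.smulRight (v₁ - v₂) := by
    ext h
    simp only [sub_apply, add_apply, ContinuousLinearMap.smulRight_apply]
    module
  have hN : 0 ≤ N := (norm_nonneg _).trans hc
  have k1 : ‖(c₁ - c₂).smulRight v₁‖ ≤ N * a * M := by
    rw [ContinuousLinearMap.norm_smulRight_apply]
    exact mul_le_mul hcc hv (norm_nonneg _) ((norm_nonneg _).trans hcc)
  have k2 : ‖c₂.smulRight (v₁ - v₂)‖ ≤ N * (M * a) := by
    rw [ContinuousLinearMap.norm_smulRight_apply]
    exact mul_le_mul hc hvv (norm_nonneg _) hN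
  rw [e]
  linarith [norm_add_le ((c₁ - c₂).smulRight v₁) (c₂.smulRight (v₁ - v₂))]

/-- Real-valued `C^{2,α}` functions on a convex set of diameter at most one can be multiplied. -/
theorem C2HolderOn.mul {α M N : ℝ} (hα1 : α ≤ 1) {s : Set E} (hs : Convex ℝ s)
    (hd : ∀ x ∈ s, ∀ y ∈ s, ‖x - y‖ ≤ 1) (hM : 0 ≤ M) (hN : 0 ≤ N)
    {f g : E → ℝ} {f' g' : E → E →L[ℝ] ℝ} {f'' g'' : E → E →L[ℝ] E →L[ℝ] ℝ}
    (hf : C2HolderOn α s f f' f'' N) (hg : C2HolderOn α s g g' g'' M) :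
    C2HolderOn α s (fun x => f x * g x) (fun x => f x • g' x + g x • f' x)
      (fun x => (f x • g'' x + (f' x).smulRight (g' x)) +
        (g x • f'' x + (g' x).smulRight (f' x))) (8 * (N * M)) := by
  have hNM : 0 ≤ N * M := mul_nonneg hN hM
  have br : ∀ {c v : E →L[ℝ] ℝ} {A B : ℝ},
      ‖c‖ ≤ A → ‖v‖ ≤ B → ‖c.smulRight v‖ ≤ A * B := by
    intro c v A B hc hv
    rw [ContinuousLinearMap.norm_smulRight_apply]
    exact mul_le_mul hc hv (norm_nonneg _) ((norm_nonneg _).trans hc)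
  refine ⟨⟨fun x hx => (hf.fst x hx).fun_mul (hg.fst x hx), fun x hx =>
    ((hf.fst x hx).fun_smul (hg.snd x hx)).add ((hg.fst x hx).fun_smul (hf.snd x hx))⟩,
    fun x hx => ?_, fun x hx => ?_, fun x hx => ?_, fun x hx y hy => ?_⟩
  · have := norm_smul_le_mul (hf.bound x hx) (hg.bound x hx)
    rw [smul_eq_mul] at this
    linarith
  · have k1 := norm_smul_le_mul (hf.bound x hx) (hg.bound_fst x hx)
    have k2 := norm_smul_le_mul (hg.bound x hx) (hf.bound_fst x hx)
    linarith [norm_add_le_of_le k1 k2]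
  · have k1 := norm_smul_le_mul (hf.bound x hx) (hg.bound_snd x hx)
    have k2 := br (hf.bound_fst x hx) (hg.bound_fst x hx)
    have k3 := norm_smul_le_mul (hg.bound x hx) (hf.bound_snd x hx)
    have k4 := br (hg.bound_fst x hx) (hf.bound_fst x hx)
    linarith [norm_add_le_of_le (norm_add_le_of_le k1 k2) (norm_add_le_of_le k3 k4)]
  · have hxy : ‖x - y‖ ≤ ‖x - y‖ ^ α := le_rpow_of_le_one' (norm_nonneg _) (hd x hx y hy) hα1
    have f0 : ‖f x - f y‖ ≤ N * ‖x - y‖ ^ α := (hf.lipschitz hs hx hy).trans (by gcongr)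
    have f1 : ‖f' x - f' y‖ ≤ N * ‖x - y‖ ^ α := (hf.lipschitz_fst hs hx hy).trans (by gcongr)
    have g0 : ‖g x - g y‖ ≤ M * ‖x - y‖ ^ α := (hg.lipschitz hs hx hy).trans (by gcongr)
    have g1 : ‖g' x - g' y‖ ≤ M * ‖x - y‖ ^ α := (hg.lipschitz_fst hs hx hy).trans (by gcongr)
    have k1 := norm_smul_sub_smul_le (hf.bound y hy) (hg.bound_snd x hx) f0 (hg.holder x hx y hy)
    have k2 := norm_smulRight_sub_smulRight_le (hf.bound_fst y hy) (hg.bound_fst x hx) f1 g1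
    have k3 := norm_smul_sub_smul_le (hg.bound y hy) (hf.bound_snd x hx) g0 (hf.holder x hx y hy)
    have k4 := norm_smulRight_sub_smulRight_le (hg.bound_fst y hy) (hf.bound_fst x hx) g1 f1
    have := norm_add_le_of_le (norm_add_le_of_le k1 k2) (norm_add_le_of_le k3 k4)
    rw [add_sub_add_comm, add_sub_add_comm (f x • g'' x), add_sub_add_comm (g x • f'' x)]
    linarith

/-- Multiplication by a cutoff function turns functions that are `C^{2,α}` on a small ball into
globally `C^{2,α}` functions, linearly in the bounds. -/
theorem exists_C2HolderOn_cutoff_mul {α : ℝ} (hα0 : 0 < α) (hα1 : α ≤ 1) {z : E} {r : ℝ}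
    (hr : r ≤ 1 / 2) {χ : E → ℝ} (hχ : ContDiff ℝ 3 χ) (hc : HasCompactSupport χ)
    (hsupp : tsupport χ ⊆ ball z r) :
    ∃ K : ℝ, 0 ≤ K ∧ ∀ (g : E → ℝ) (g' : E → E →L[ℝ] ℝ) (g'' : E → E →L[ℝ] E →L[ℝ] ℝ) (M : ℝ),
      0 ≤ M → C2HolderOn α (ball z r) g g' g'' M →
      ∃ f' f'', C2HolderOn α univ (fun x => χ x * g x) f' f'' (K * M) := by
  have hχ1 : ContDiff ℝ 2 (fderiv ℝ χ) := hχ.fderiv_right (by norm_num)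
  have hχ2 : ContDiff ℝ 1 (fderiv ℝ (fderiv ℝ χ)) := hχ1.fderiv_right (by norm_num)
  have hχ3 : ContDiff ℝ 0 (fderiv ℝ (fderiv ℝ (fderiv ℝ χ))) := hχ2.fderiv_right (by norm_num)
  have hc1 := hc.fderiv (𝕜 := ℝ)
  have hc2 := hc1.fderiv (𝕜 := ℝ)
  have hc3 := hc2.fderiv (𝕜 := ℝ)
  obtain ⟨N0, hN0⟩ := hχ.continuous.bounded_above_of_compact_support hc
  obtain ⟨N1, hN1⟩ := hχ1.continuous.bounded_above_of_compact_support hc1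
  obtain ⟨N2, hN2⟩ := hχ2.continuous.bounded_above_of_compact_support hc2
  obtain ⟨N3, hN3⟩ := hχ3.continuous.bounded_above_of_compact_support hc3
  have p0 := (norm_nonneg _).trans (hN0 z)
  have p1 := (norm_nonneg _).trans (hN1 z)
  have p2 := (norm_nonneg _).trans (hN2 z)
  have p3 := (norm_nonneg _).trans (hN3 z)
  set N := N0 + N1 + N2 + N3 with hN
  have hNn : 0 ≤ N := by positivity
  have hd : ∀ x ∈ ball z r, ∀ y ∈ ball z r, ‖x - y‖ ≤ 1 := by
    intro x hx y hy
    rw [mem_ball] at hx hy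
    rw [← dist_eq_norm]
    linarith [dist_triangle_right x y z]
  have hχH : C2HolderOn α (ball z r) χ (fderiv ℝ χ) (fderiv ℝ (fderiv ℝ χ)) N := by
    refine ⟨⟨fun x _ => ?_, fun x _ => ?_⟩, fun x _ => ?_, fun x _ => ?_, fun x _ => ?_,
      fun x hx y hy => ?_⟩
    · exact (hχ.differentiable (by norm_num) x).hasFDerivAt.hasFDerivWithinAt
    · exact (hχ1.differentiable (by norm_num) x).hasFDerivAt.hasFDerivWithinAt
    · linarith [hN0 x]
    · linarith [hN1 x]
    · linarith [hN2 x]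
    · have := (convex_ball z r).norm_image_sub_le_of_norm_hasFDerivWithin_le
        (f := fderiv ℝ (fderiv ℝ χ)) (fun w _ =>
          (hχ2.differentiable (by norm_num) w).hasFDerivAt.hasFDerivWithinAt)
        (fun w _ => (hN3 w).trans (show N3 ≤ N by linarith)) hy hx
      refine this.trans ?_
      gcongr
      exact le_rpow_of_le_one' (norm_nonneg _) (hd x hx y hy) hα1
  obtain ⟨δ, hδ, hδs⟩ := IsCompact.exists_thickening_subset_open hc isOpen_ball hsupp
  have hδ' : ∀ x ∈ tsupport χ, ∀ y ∉ ball z r, δ ≤ ‖x - y‖ := by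
    intro x hx y hy
    by_contra! hlt
    exact hy (hδs (mem_thickening_iff.2 ⟨x, hx, by rwa [dist_comm, dist_eq_norm]⟩))
  have hδp : 0 < δ ^ α := Real.rpow_pos_of_pos hδ α
  refine ⟨8 * N * (1 + (δ ^ α)⁻¹), by positivity, fun g g' g'' M hM hg => ?_⟩
  have hfg := C2HolderOn.mul hα1 (convex_ball z r) hd hM hNn hχH hg
  have z0 : ∀ x ∉ tsupport χ, χ x = 0 := fun x hx => image_eq_zero_of_notMem_tsupport hx
  have z1 : ∀ x ∉ tsupport χ, fderiv ℝ χ x = 0 := fun x hx =>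
    image_eq_zero_of_notMem_tsupport fun h => hx (tsupport_fderiv_subset ℝ h)
  have z2 : ∀ x ∉ tsupport χ, fderiv ℝ (fderiv ℝ χ) x = 0 := fun x hx =>
    image_eq_zero_of_notMem_tsupport fun h =>
      hx (tsupport_fderiv_subset ℝ (tsupport_fderiv_subset ℝ h))
  set f := fun x => χ x * g x with hf
  set f' := fun x => χ x • g' x + g x • fderiv ℝ χ x with hf'
  set f'' := fun x => (χ x • g'' x + (fderiv ℝ χ x).smulRight (g' x)) +
        (g x • fderiv ℝ (fderiv ℝ χ) x + (g' x).smulRight (fderiv ℝ χ x)) with hf''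
  have y0 : ∀ x ∉ tsupport χ, f x = 0 := fun x hx => by simp [hf, z0 x hx]
  have y1 : ∀ x ∉ tsupport χ, f' x = 0 := fun x hx => by simp [hf', z0 x hx, z1 x hx]
  have y2 : ∀ x ∉ tsupport χ, f'' x = 0 := fun x hx => by
    simp only [hf'', z0 x hx, z1 x hx, z2 x hx, zero_smul, smul_zero]
    ext h k
    simp
  have hopen : IsOpen (tsupport χ)ᶜ := (isClosed_tsupport χ).isOpen_compl
  have hNM : 0 ≤ N * M := mul_nonneg hNn hM
  have hle : 8 * (N * M) ≤ 8 * N * (1 + (δ ^ α)⁻¹) * M := by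
    have : 0 ≤ N * M * (δ ^ α)⁻¹ := by positivity
    nlinarith
  have hle0 := (mul_nonneg (by norm_num : (0 : ℝ) ≤ 8) hNM).trans hle
  have far : ∀ x ∈ tsupport χ, ∀ y ∉ ball z r,
      ‖f'' x - f'' y‖ ≤ 8 * N * (1 + (δ ^ α)⁻¹) * M * ‖x - y‖ ^ α := by
    intro x hx y hy
    rw [y2 y fun h => hy (hsupp h), sub_zero]
    have k1 := hfg.bound_snd x (hsupp hx)
    have k2 : δ ^ α ≤ ‖x - y‖ ^ α := by
      gcongr
      exact hδ' x hx y hy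
    calc ‖f'' x‖ ≤ 8 * (N * M) := k1
      _ = 8 * (N * M) * (δ ^ α)⁻¹ * δ ^ α := by field_simp
      _ ≤ 8 * (N * M) * (δ ^ α)⁻¹ * ‖x - y‖ ^ α := by gcongr
      _ ≤ 8 * N * (1 + (δ ^ α)⁻¹) * M * ‖x - y‖ ^ α := by
          gcongr ?_ * _
          rw [show 8 * N * (1 + (δ ^ α)⁻¹) * M = 8 * (N * M) + 8 * (N * M) * (δ ^ α)⁻¹ by ring]
          linarith
  refine ⟨f', f'', ⟨fun x _ => ?_, fun x _ => ?_⟩, fun x _ => ?_, fun x _ => ?_, fun x _ => ?_,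
    fun x _ y _ => ?_⟩
  · rw [hasFDerivWithinAt_univ]
    by_cases hx : x ∈ tsupport χ
    · exact (hfg.fst x (hsupp hx)).hasFDerivAt (isOpen_ball.mem_nhds (hsupp hx))
    · rw [y1 x hx]
      refine (hasFDerivAt_const (0 : ℝ) x).congr_of_eventuallyEq ?_
      filter_upwards [hopen.mem_nhds hx] with y hy using y0 y hy
  · rw [hasFDerivWithinAt_univ]
    by_cases hx : x ∈ tsupport χ
    · exact (hfg.snd x (hsupp hx)).hasFDerivAt (isOpen_ball.mem_nhds (hsupp hx))
    · rw [y2 x hx]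
      refine (hasFDerivAt_const (0 : E →L[ℝ] ℝ) x).congr_of_eventuallyEq ?_
      filter_upwards [hopen.mem_nhds hx] with y hy using y1 y hy
  · by_cases hx : x ∈ tsupport χ
    · exact (hfg.bound x (hsupp hx)).trans hle
    · rw [y0 x hx, norm_zero]; exact hle0
  · by_cases hx : x ∈ tsupport χ
    · exact (hfg.bound_fst x (hsupp hx)).trans hle
    · rw [y1 x hx, norm_zero]; exact hle0
  · by_cases hx : x ∈ tsupport χ
    · exact (hfg.bound_snd x (hsupp hx)).trans hle
    · rw [y2 x hx, norm_zero]; exact hle0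
  · by_cases hx : x ∈ ball z r
    · by_cases hy : y ∈ ball z r
      · exact (hfg.holder x hx y hy).trans (by gcongr)
      · by_cases hx' : x ∈ tsupport χ
        · exact far x hx' y hy
        · rw [y2 x hx', y2 y fun h => hy (hsupp h), sub_zero, norm_zero]
          positivity
    · by_cases hy' : y ∈ tsupport χ
      · rw [norm_sub_rev, norm_sub_rev x y]
        exact far y hy' x hx
      · rw [y2 y hy', y2 x fun h => hx (hsupp h), sub_zero, norm_zero]
        positivity

end Cutoff

section IteratedDerivative

set_option maxSynthPendingDepth 3

variable {E F : Type*} [NormedAddCommGroup E] [NormedSpace ℝ E]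
  [NormedAddCommGroup F] [NormedSpace ℝ F] {s : Set E} {f : E → F}

theorem edist_iteratedFDerivWithin_succ (hs : UniqueDiffOn ℝ s) (n : ℕ) {x y : E} (hx : x ∈ s)
    (hy : y ∈ s) :
    edist (iteratedFDerivWithin ℝ (n + 1) f s x) (iteratedFDerivWithin ℝ (n + 1) f s y) =
      edist (iteratedFDerivWithin ℝ n (fderivWithin ℝ f s) s x)
        (iteratedFDerivWithin ℝ n (fderivWithin ℝ f s) s y) := by
  rw [iteratedFDerivWithin_succ_eq_comp_right hs hx, iteratedFDerivWithin_succ_eq_comp_right hs hy]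
  exact LinearIsometryEquiv.edist_map _ _ _

theorem edist_iteratedFDerivWithin_zero (x y : E) :
    edist (iteratedFDerivWithin ℝ 0 f s x) (iteratedFDerivWithin ℝ 0 f s y) =
      edist (f x) (f y) := by
  rw [iteratedFDerivWithin_zero_eq_comp]
  exact LinearIsometryEquiv.edist_map _ _ _

theorem holderOnWith_iteratedFDerivWithin_succ (hs : UniqueDiffOn ℝ s) (n : ℕ) {C α : ℝ≥0} :
    HolderOnWith C α (iteratedFDerivWithin ℝ (n + 1) f s) s ↔
      HolderOnWith C α (iteratedFDerivWithin ℝ n (fderivWithin ℝ f s) s) s :=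
  forall₄_congr fun _ hx _ hy => by rw [edist_iteratedFDerivWithin_succ hs n hx hy]

theorem holderOnWith_iteratedFDerivWithin_two (hs : UniqueDiffOn ℝ s) {C α : ℝ≥0} :
    HolderOnWith C α (iteratedFDerivWithin ℝ 2 f s) s ↔
      HolderOnWith C α (fderivWithin ℝ (fderivWithin ℝ f s) s) s := by
  rw [holderOnWith_iteratedFDerivWithin_succ hs 1, holderOnWith_iteratedFDerivWithin_succ hs 0]
  exact forall₄_congr fun _ _ _ _ => by rw [edist_iteratedFDerivWithin_zero]

theorem norm_iteratedFDerivWithin_one' (hs : UniqueDiffOn ℝ s) {x : E} (hx : x ∈ s) :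
    ‖iteratedFDerivWithin ℝ 1 f s x‖ = ‖fderivWithin ℝ f s x‖ := by
  rw [← norm_iteratedFDerivWithin_fderivWithin hs hx, norm_iteratedFDerivWithin_zero]

theorem norm_iteratedFDerivWithin_two (hs : UniqueDiffOn ℝ s) {x : E} (hx : x ∈ s) :
    ‖iteratedFDerivWithin ℝ 2 f s x‖ = ‖fderivWithin ℝ (fderivWithin ℝ f s) s x‖ := by
  rw [← norm_iteratedFDerivWithin_fderivWithin hs hx, norm_iteratedFDerivWithin_one' hs hx]

theorem ContDiffOn.hasTwoFDerivsOn (hf : ContDiffOn ℝ 2 f s) (hs : UniqueDiffOn ℝ s) :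
    HasTwoFDerivsOn s f (fderivWithin ℝ f s) (fderivWithin ℝ (fderivWithin ℝ f s) s) :=
  ⟨fun x hx => (hf.differentiableOn (by norm_num) x hx).hasFDerivWithinAt, fun x hx =>
    ((hf.fderivWithin hs (m := 1) (by norm_num)).differentiableOn
      (by norm_num) x hx).hasFDerivWithinAt⟩

theorem ContDiffOn.continuousOn_fderivWithin_two (hf : ContDiffOn ℝ 2 f s)
    (hs : UniqueDiffOn ℝ s) : ContinuousOn (fderivWithin ℝ (fderivWithin ℝ f s) s) s :=
  (hf.fderivWithin hs (m := 1) (by norm_num)).continuousOn_fderivWithin hs (by norm_num)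

theorem ContDiffOn.c2HolderOn (hf : ContDiffOn ℝ 2 f s) (hs : UniqueDiffOn ℝ s) {M α : ℝ≥0}
    (hb : ∀ i : ℕ, i ≤ 2 → ∀ x ∈ s, ‖iteratedFDerivWithin ℝ i f s x‖ ≤ (M : ℝ))
    (hh : HolderOnWith M α (iteratedFDerivWithin ℝ 2 f s) s) :
    C2HolderOn α s f (fderivWithin ℝ f s) (fderivWithin ℝ (fderivWithin ℝ f s) s) M where
  toHasTwoFDerivsOn := hf.hasTwoFDerivsOn hs
  bound x hx := by simpa using hb 0 (by norm_num) x hx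
  bound_fst x hx := by rw [← norm_iteratedFDerivWithin_one' hs hx]; exact hb 1 (by norm_num) x hx
  bound_snd x hx := by rw [← norm_iteratedFDerivWithin_two hs hx]; exact hb 2 le_rfl x hx
  holder x hx y hy := by
    simpa only [dist_eq_norm] using
      ((holderOnWith_iteratedFDerivWithin_two hs).1 hh).dist_le hx hy

theorem holderOnWith_of_norm_sub_le {E F : Type*} [SeminormedAddCommGroup E]
    [SeminormedAddCommGroup F] {s : Set E} {f : E → F} {C α : ℝ≥0}
    (h : ∀ x ∈ s, ∀ y ∈ s, ‖f x - f y‖ ≤ C * ‖x - y‖ ^ (α : ℝ)) : HolderOnWith C α f s := by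
  intro x hx y hy
  have := h x hx y hy
  rw [edist_nndist, edist_nndist, ← ENNReal.coe_rpow_of_nonneg _ (NNReal.coe_nonneg α),
    ← ENNReal.coe_mul, ENNReal.coe_le_coe, ← NNReal.coe_le_coe]
  simpa [dist_eq_norm] using this

theorem HasTwoFDerivsOn.fderiv_eq {f' : E → E →L[ℝ] F} {f'' : E → E →L[ℝ] E →L[ℝ] F}
    (h : HasTwoFDerivsOn univ f f' f'') : fderiv ℝ f = f' :=
  funext fun x => (hasFDerivWithinAt_univ.1 (h.fst x trivial)).fderiv

theorem HasTwoFDerivsOn.fderiv_fderiv_eq {f' : E → E →L[ℝ] F} {f'' : E → E →L[ℝ] E →L[ℝ] F}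
    (h : HasTwoFDerivsOn univ f f' f'') : fderiv ℝ (fderiv ℝ f) = f'' := by
  rw [h.fderiv_eq]
  exact funext fun x => (hasFDerivWithinAt_univ.1 (h.snd x trivial)).fderiv

theorem C2HolderOn.holderWith_iteratedFDeriv {M α : ℝ≥0} {f' : E → E →L[ℝ] F}
    {f'' : E → E →L[ℝ] E →L[ℝ] F} (h : C2HolderOn α univ f f' f'' M) :
    HolderWith M α (iteratedFDeriv ℝ 2 f) := by
  rw [← holderOnWith_univ, ← iteratedFDerivWithin_univ,
    holderOnWith_iteratedFDerivWithin_two uniqueDiffOn_univ, fderivWithin_univ, fderivWithin_univ,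
    h.fderiv_fderiv_eq]
  exact holderOnWith_of_norm_sub_le h.holder

theorem C2HolderOn.norm_iteratedFDeriv_le {M α : ℝ} {f' : E → E →L[ℝ] F}
    {f'' : E → E →L[ℝ] E →L[ℝ] F} (h : C2HolderOn α univ f f' f'' M) {i : ℕ} (hi : i ≤ 2) (x : E) :
    ‖iteratedFDeriv ℝ i f x‖ ≤ M := by
  rw [← iteratedFDerivWithin_univ]
  interval_cases i
  · simpa using h.bound x trivial
  · rw [norm_iteratedFDerivWithin_one' uniqueDiffOn_univ trivial, fderivWithin_univ, h.fderiv_eq]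
    exact h.bound_fst x trivial
  · rw [norm_iteratedFDerivWithin_two uniqueDiffOn_univ trivial, fderivWithin_univ,
      fderivWithin_univ, h.fderiv_fderiv_eq]
    exact h.bound_snd x trivial

theorem C2HolderOn.contDiff {M α : ℝ≥0} (hα : 0 < α) {f' : E → E →L[ℝ] F}
    {f'' : E → E →L[ℝ] E →L[ℝ] F} (h : C2HolderOn α univ f f' f'' M) : ContDiff ℝ 2 f := by
  have hc : Continuous f'' :=
    (holderOnWith_univ.1 (holderOnWith_of_norm_sub_le h.holder)).continuous hα
  have h1 : ContDiff ℝ 1 f' :=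
    contDiff_one_iff_hasFDerivAt.2 ⟨f'', hc, fun x => hasFDerivWithinAt_univ.1 (h.snd x trivial)⟩
  exact (contDiff_succ_iff_hasFDerivAt (n := 1)).2
    ⟨f', h1, fun x => hasFDerivWithinAt_univ.1 (h.fst x trivial)⟩

end IteratedDerivative

section LocalClass

set_option maxSynthPendingDepth 3

variable {E F G : Type*} [NormedAddCommGroup E] [NormedSpace ℝ E]
  [NormedAddCommGroup F] [NormedSpace ℝ F] [NormedAddCommGroup G] [NormedSpace ℝ G]

/-- `f` is of class `C^{2,α}` within `s` near `x`. -/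
def C2HolderAt (α : ℝ) (s : Set E) (x : E) (f : E → F) : Prop :=
  ∃ r > 0, ∃ f' f'' M, C2HolderOn α (ball x r ∩ s) f f' f'' M

theorem norm_sub_le_one_of_mem_ball {E : Type*} [SeminormedAddCommGroup E] {x : E} {r : ℝ}
    (hr : r ≤ 1 / 2) (s : Set E) :
    ∀ y ∈ ball x r ∩ s, ∀ z ∈ ball x r ∩ s, ‖y - z‖ ≤ 1 := by
  intro y hy z hz
  have h1 := mem_ball.1 hy.1
  have h2 := mem_ball.1 hz.1
  rw [← dist_eq_norm]
  linarith [dist_triangle_right y z x]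

namespace C2HolderAt

variable {α : ℝ} {s : Set E} {x : E} {f g : E → F}

theorem exists_ball (hf : C2HolderAt α s x f) {O : Set E} (hO : O ∈ 𝓝 x) :
    ∃ r, 0 < r ∧ r ≤ 1 / 2 ∧ ball x r ⊆ O ∧
      ∃ f' f'' N, 1 ≤ N ∧ C2HolderOn α (ball x r ∩ s) f f' f'' N := by
  obtain ⟨r₁, hr₁, f', f'', M, h⟩ := hf
  obtain ⟨r₂, hr₂, hO⟩ := Metric.mem_nhds_iff.1 hO
  refine ⟨min (min r₁ r₂) (1 / 2), by positivity, min_le_right _ _,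
    (ball_subset_ball ((min_le_left _ _).trans (min_le_right _ _))).trans hO,
    f', f'', max M 1, le_max_right _ _, ?_⟩
  exact (h.mono (inter_subset_inter_left s
    (ball_subset_ball ((min_le_left _ _).trans (min_le_left _ _))))).mono_const (le_max_left _ _)

theorem continuousWithinAt (hf : C2HolderAt α s x f) (hx : x ∈ s) : ContinuousWithinAt f s x := by
  obtain ⟨r, hr, f', f'', M, h⟩ := hf
  exact ((h.fst x ⟨mem_ball_self hr, hx⟩).continuousWithinAt).mono_of_mem_nhdsWithin
    (Filter.inter_mem (mem_nhdsWithin_of_mem_nhds (ball_mem_nhds x hr)) self_mem_nhdsWithin)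

theorem comp {t : Set F} {g : F → G} (hα0 : 0 < α) (hα1 : α ≤ 1) (hs : Convex ℝ s) (hx : x ∈ s)
    (hg : C2HolderAt α t (f x) g) (hf : C2HolderAt α s x f) (hst : ∀ᶠ y in 𝓝[s] x, f y ∈ t) :
    C2HolderAt α s x (g ∘ f) := by
  obtain ⟨r, hr, -, -, g', g'', M, hM, hg⟩ := hg.exists_ball Filter.univ_mem
  have : ∀ᶠ y in 𝓝[s] x, f y ∈ ball (f x) r ∩ t :=
    ((hf.continuousWithinAt hx).eventually (ball_mem_nhds _ hr)).and hst
  obtain ⟨O, hO, hOs⟩ := mem_nhdsWithin_iff_exists_mem_nhds_inter.1 this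
  obtain ⟨r', hr', hr2, hrO, f', f'', N, hN, hf⟩ := hf.exists_ball hO
  exact ⟨r', hr', _, _, _, hg.comp hα0 hα1 hN (by linarith) ((convex_ball x r').inter hs)
    (norm_sub_le_one_of_mem_ball hr2 s) hf fun y hy => hOs ⟨hrO hy.1, hy.2⟩⟩

theorem add (hf : C2HolderAt α s x f) (hg : C2HolderAt α s x g) : C2HolderAt α s x (f + g) := by
  obtain ⟨r, hr, f', f'', M, hf⟩ := hf
  obtain ⟨r', hr', -, hrr, g', g'', N, -, hg⟩ := hg.exists_ball (ball_mem_nhds x hr)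
  exact ⟨r', hr', _, _, _, (hf.mono (inter_subset_inter_left s hrr)).add hg⟩

theorem sum {ι : Type*} (I : Finset ι) {f : ι → E → F} (h : ∀ i, C2HolderAt α s x (f i)) :
    C2HolderAt α s x (∑ i ∈ I, f i) := by
  classical
  induction I using Finset.induction_on with
  | empty => exact ⟨1, one_pos, 0, 0, 0, by simpa using C2HolderOn.zero⟩
  | insert i I hi ih =>
    rw [Finset.sum_insert hi]
    exact (h i).add ih

theorem of_hasTwoFDerivsOn {O : Set E} (hO : O ∈ 𝓝 x) (hx : x ∈ s) {f' : E → E →L[ℝ] F}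
    {f'' : E → E →L[ℝ] E →L[ℝ] F} (h : HasTwoFDerivsOn (O ∩ s) f f' f'')
    (hc : ContinuousWithinAt f'' (O ∩ s) x) {C : ℝ}
    (hC : ∀ y ∈ O ∩ s, ∀ z ∈ O ∩ s, ‖f'' y - f'' z‖ ≤ C * ‖y - z‖ ^ α) : C2HolderAt α s x f := by
  have hxO : x ∈ O ∩ s := ⟨mem_of_mem_nhds hO, hx⟩
  have e0 : ∀ᶠ y in 𝓝[O ∩ s] x, ‖f y‖ ≤ ‖f x‖ + 1 :=
    ((h.fst x hxO).continuousWithinAt.norm.eventually_lt_const (lt_add_one _)).mono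
      fun _ => le_of_lt
  have e1 : ∀ᶠ y in 𝓝[O ∩ s] x, ‖f' y‖ ≤ ‖f' x‖ + 1 :=
    ((h.snd x hxO).continuousWithinAt.norm.eventually_lt_const (lt_add_one _)).mono
      fun _ => le_of_lt
  have e2 : ∀ᶠ y in 𝓝[O ∩ s] x, ‖f'' y‖ ≤ ‖f'' x‖ + 1 :=
    (hc.norm.eventually_lt_const (lt_add_one _)).mono fun _ => le_of_lt
  obtain ⟨P, hP, hPs⟩ := mem_nhdsWithin_iff_exists_mem_nhds_inter.1 (e0.and (e1.and e2))
  obtain ⟨r, hr, hrO⟩ := Metric.mem_nhds_iff.1 (Filter.inter_mem hO hP)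
  have hsub : ball x r ∩ s ⊆ O ∩ s := fun y hy => ⟨(hrO hy.1).1, hy.2⟩
  have hb : ∀ y ∈ ball x r ∩ s, ‖f y‖ ≤ ‖f x‖ + 1 ∧ ‖f' y‖ ≤ ‖f' x‖ + 1 ∧ ‖f'' y‖ ≤ ‖f'' x‖ + 1 :=
    fun y hy => hPs ⟨(hrO hy.1).2, (hrO hy.1).1, hy.2⟩
  refine ⟨r, hr, f', f'', |C| + (‖f x‖ + 1) + (‖f' x‖ + 1) + (‖f'' x‖ + 1), h.mono hsub,
    fun y hy => ?_, fun y hy => ?_, fun y hy => ?_, fun y hy z hz => ?_⟩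
  · linarith [(hb y hy).1, norm_nonneg (f' x), norm_nonneg (f'' x), abs_nonneg C]
  · linarith [(hb y hy).2.1, norm_nonneg (f x), norm_nonneg (f'' x), abs_nonneg C]
  · linarith [(hb y hy).2.2, norm_nonneg (f' x), norm_nonneg (f x), abs_nonneg C]
  · refine (hC y (hsub hy) z (hsub hz)).trans ?_
    gcongr
    linarith [le_abs_self C, norm_nonneg (f x), norm_nonneg (f' x), norm_nonneg (f'' x)]

theorem of_holderOnWith {α : ℝ≥0} (hs : UniqueDiffOn ℝ s) (hf : ContDiffOn ℝ 2 f s) {C : ℝ≥0}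
    (hC : HolderOnWith C α (iteratedFDerivWithin ℝ 2 f s) s) (hx : x ∈ s) :
    C2HolderAt α s x f := by
  refine of_hasTwoFDerivsOn (O := univ) (C := C) Filter.univ_mem hx
    (by simpa using hf.hasTwoFDerivsOn hs)
    (by simpa using hf.continuousOn_fderivWithin_two hs x hx) fun y hy z hz => ?_
  simpa only [dist_eq_norm] using
    ((holderOnWith_iteratedFDerivWithin_two hs).1 hC).dist_le hy.2 hz.2

theorem of_contDiffAt (hα1 : α ≤ 1) (hf : ContDiffAt ℝ 3 f x) : C2HolderAt α univ x f := by
  have hf1 : ContDiffAt ℝ 2 (fderiv ℝ f) x := hf.fderiv_right (by norm_num)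
  have hf2 : ContDiffAt ℝ 1 (fderiv ℝ (fderiv ℝ f)) x := hf1.fderiv_right (by norm_num)
  obtain ⟨C, O, hO, hC⟩ := hf2.exists_lipschitzOnWith
  have ev : ∀ᶠ y in 𝓝 x, ContDiffAt ℝ 3 f y := hf.eventually (by simp)
  have ev' : {y | ContDiffAt ℝ 3 f y} ∩ O ∩ ball x (1 / 2) ∈ 𝓝 x :=
    Filter.inter_mem (Filter.inter_mem ev hO) (ball_mem_nhds x (by norm_num))
  refine of_hasTwoFDerivsOn (f' := fderiv ℝ f) (f'' := fderiv ℝ (fderiv ℝ f)) (C := C) ev' trivial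
    ⟨fun y hy => ?_, fun y hy => ?_⟩ hf2.continuousAt.continuousWithinAt fun y hy z hz => ?_
  · have : ContDiffAt ℝ 3 f y := hy.1.1.1
    exact (this.differentiableAt (by norm_num)).hasFDerivAt.hasFDerivWithinAt
  · have h3 : ContDiffAt ℝ 3 f y := hy.1.1.1
    have : ContDiffAt ℝ 2 (fderiv ℝ f) y := h3.fderiv_right (by norm_num)
    exact (this.differentiableAt (by norm_num)).hasFDerivAt.hasFDerivWithinAt
  · refine (hC.norm_sub_le hy.1.1.2 hz.1.1.2).trans ?_
    gcongr
    exact le_rpow_of_le_one' (norm_nonneg _)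
      (norm_sub_le_one_of_mem_ball le_rfl univ y ⟨hy.1.2, trivial⟩ z ⟨hz.1.2, trivial⟩) hα1

theorem contDiffAt_comp {g : F → G} (hα0 : 0 < α) (hα1 : α ≤ 1) (hs : Convex ℝ s) (hx : x ∈ s)
    (hg : ContDiffAt ℝ 3 g (f x)) (hf : C2HolderAt α s x f) : C2HolderAt α s x (g ∘ f) :=
  (of_contDiffAt hα1 hg).comp hα0 hα1 hs hx hf (by simp)

theorem prodMk {g : E → G} (hα0 : 0 < α) (hα1 : α ≤ 1) (hs : Convex ℝ s) (hx : x ∈ s)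
    (hf : C2HolderAt α s x f) (hg : C2HolderAt α s x g) :
    C2HolderAt α s x (fun y => (f y, g y)) := by
  have h1 := hf.contDiffAt_comp hα0 hα1 hs hx (g := ContinuousLinearMap.inl ℝ F G)
    (ContinuousLinearMap.contDiff _).contDiffAt
  have h2 := hg.contDiffAt_comp hα0 hα1 hs hx (g := ContinuousLinearMap.inr ℝ F G)
    (ContinuousLinearMap.contDiff _).contDiffAt
  convert h1.add h2 using 1
  ext y <;> simp

theorem pi {ι : Type*} [Fintype ι] [DecidableEq ι] {f : ι → E → F} (hα0 : 0 < α) (hα1 : α ≤ 1)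
    (hs : Convex ℝ s) (hx : x ∈ s) (hf : ∀ i, C2HolderAt α s x (f i)) :
    C2HolderAt α s x (fun y i => f i y) := by
  have h1 := C2HolderAt.sum Finset.univ fun i =>
    (hf i).contDiffAt_comp hα0 hα1 hs hx (g := ContinuousLinearMap.single ℝ (fun _ : ι => F) i)
      (ContinuousLinearMap.contDiff _).contDiffAt
  convert h1 using 1
  ext y j
  simp [Finset.sum_apply, Pi.single_apply]

end C2HolderAt

end LocalClass

section Reflection

set_option maxSynthPendingDepth 3

variable {E F : Type*} [NormedAddCommGroup E] [NormedSpace ℝ E]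
  [NormedAddCommGroup F] [NormedSpace ℝ F]

/-- The projection along `ν` onto the kernel of the functional `l`, where `l ν = 1`. -/
def kerProj (l : E →L[ℝ] ℝ) (ν : E) (y : E) : E := y - l y • ν

/-- A quadratic perturbation, along the lines parallel to `ν`, of the reflection across the
kernel of the functional `l`, where `l ν = 1`. -/
def quadReflection (l : E →L[ℝ] ℝ) (ν : E) (X : E → E) (q : E → ℝ) (y : E) : E :=
  y - l y • X (kerProj l ν y) + (l y ^ 2 * q (kerProj l ν y)) • ν

variable {l : E →L[ℝ] ℝ} {ν : E} {X : E → E} {q : E → ℝ}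

theorem apply_kerProj (hν : l ν = 1) (y : E) : l (kerProj l ν y) = 0 := by
  simp [kerProj, hν]

theorem kerProj_of_apply_eq_zero {y : E} (hy : l y = 0) : kerProj l ν y = y := by
  simp [kerProj, hy]

theorem contDiff_kerProj : ContDiff ℝ 3 (kerProj l ν) := by
  unfold kerProj
  fun_prop

theorem quadReflection_of_apply_eq_zero {y : E} (hy : l y = 0) : quadReflection l ν X q y = y := by
  simp [quadReflection, hy]

theorem quadReflection_add_smul (hν : l ν = 1) {y : E} (hy : l y = 0) (t : ℝ) :
    quadReflection l ν X q (y + t • ν) = y + t • (ν - X y) + (t ^ 2 * q y) • ν := by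
  simp [quadReflection, kerProj, hy, hν]
  module

theorem apply_quadReflection (hν : l ν = 1) {y : E} (hX : l (X (kerProj l ν y)) = 2) :
    l (quadReflection l ν X q y) = l y * (l y * q (kerProj l ν y) - 1) := by
  simp [quadReflection, hν, hX]
  ring

theorem HasTwoFDerivsOn.quadReflection_fst {B : Set E} (hB : IsOpen B) {P' : E → E →L[ℝ] E}
    {P'' : E → E →L[ℝ] E →L[ℝ] E} (hP : HasTwoFDerivsOn B (quadReflection l ν X q) P' P'')
    (hν : l ν = 1) {y : E} (hy : l y = 0) {t : ℝ} (ht : y + t • ν ∈ B) :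
    P' (y + t • ν) ν = ν - X y + (2 * t * q y) • ν := by
  have hline : HasDerivAt (fun r : ℝ => y + r • ν) ν t := by
    simpa using ((hasDerivAt_id t).smul_const ν).const_add y
  have h1 := ((hP.fst _ ht).hasFDerivAt (hB.mem_nhds ht)).comp_hasDerivAt t hline
  have h2 : HasDerivAt (fun r : ℝ => y + r • (ν - X y) + (r ^ 2 * q y) • ν)
      (ν - X y + (2 * t * q y) • ν) t := by
    simpa using (((hasDerivAt_id t).smul_const (ν - X y)).const_add y).fun_add
      ((((hasDerivAt_id t).pow 2).mul_const (q y)).smul_const ν)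
  refine h1.unique (h2.congr_of_eventuallyEq (Filter.Eventually.of_forall fun r => ?_))
  exact quadReflection_add_smul hν hy r

theorem HasTwoFDerivsOn.quadReflection_snd {B : Set E} (hB : IsOpen B) {P' : E → E →L[ℝ] E}
    {P'' : E → E →L[ℝ] E →L[ℝ] E} (hP : HasTwoFDerivsOn B (quadReflection l ν X q) P' P'')
    (hν : l ν = 1) {y : E} (hyB : y ∈ B) (hy : l y = 0) :
    P'' y ν ν = (2 * q y) • ν := by
  have hline : HasDerivAt (fun r : ℝ => y + r • ν) ν 0 := by
    simpa using ((hasDerivAt_id (0 : ℝ)).smul_const ν).const_add y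
  have hy0 : y + (0 : ℝ) • ν = y := by simp
  have h0 : HasFDerivAt P' (P'' y) (y + (0 : ℝ) • ν) := by
    rw [hy0]; exact (hP.snd _ hyB).hasFDerivAt (hB.mem_nhds hyB)
  have h1 : HasDerivAt (fun r : ℝ => P' (y + r • ν) ν) (P'' y ν ν) 0 := by
    exact ((ContinuousLinearMap.apply ℝ E ν).hasFDerivAt.comp (y + (0 : ℝ) • ν)
      h0).comp_hasDerivAt 0 hline
  have h2 : HasDerivAt (fun r : ℝ => ν - X y + (2 * r * q y) • ν) ((2 * q y) • ν) 0 := by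
    simpa using ((((hasDerivAt_id (0 : ℝ)).const_mul 2).mul_const (q y)).smul_const ν).const_add
      (ν - X y)
  have hmem : ∀ᶠ r : ℝ in 𝓝 0, y + r • ν ∈ B :=
    hline.continuousAt.preimage_mem_nhds (hB.mem_nhds (by simpa using hyB))
  exact h1.unique (h2.congr_of_eventuallyEq
    (hmem.mono fun r hr => hP.quadReflection_fst hB hν hy hr))

theorem ContinuousLinearMap.ext_of_ker {f g : E →L[ℝ] F} (hν : l ν = 1)
    (hker : ∀ h, l h = 0 → f h = g h) (h : f ν = g ν) : f = g := by
  ext x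
  have hx : x = (x - l x • ν) + l x • ν := by simp
  rw [hx, map_add, map_add, hker _ (by simp [hν]), map_smul, map_smul, h]

/-- The first derivative, at a point of a hyperplane, of a function vanishing on it. -/
theorem HasTwoFDerivsOn.fst_apply_of_eq_zero {B : Set E} (hB : IsOpen B) {v : E → F}
    {v' : E → E →L[ℝ] F} {v'' : E → E →L[ℝ] E →L[ℝ] F}
    (hv : HasTwoFDerivsOn (B ∩ {y | 0 ≤ l y}) v v' v'') (hν : l ν = 1)
    (hv0 : ∀ y ∈ B, l y = 0 → v y = 0) {y : E} (hyB : y ∈ B) (hy : l y = 0) (h : E) :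
    v' y h = l h • v' y ν := by
  have hsub : B ∩ {y | l y = 0} ⊆ B ∩ {y | 0 ≤ l y} := fun x hx => ⟨hx.1, hx.2.ge⟩
  have key : v' y = l.smulRight (v' y ν) := by
    refine ContinuousLinearMap.ext_of_ker hν (fun h hh => ?_) (by simp [hν])
    have := (hv.fst y (hsub ⟨hyB, hy⟩)).apply_eq_of_eqOn_ker hB
      (hasFDerivWithinAt_const (0 : F) y univ) hsub (subset_univ _)
      (fun x hx => hv0 x hx.1 hx.2) hyB hy hh
    simpa [hh] using this
  exact congrArg (fun f => f h) key

/-- The second derivative, at a point of a hyperplane, of a function vanishing on it. -/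
theorem HasTwoFDerivsOn.snd_apply_of_eq_zero {B : Set E} (hB : IsOpen B) (hBc : Convex ℝ B)
    {v : E → F} {v' : E → E →L[ℝ] F} {v'' : E → E →L[ℝ] E →L[ℝ] F}
    (hv : HasTwoFDerivsOn (B ∩ {y | 0 ≤ l y}) v v' v'') (hν : l ν = 1)
    (hv0 : ∀ y ∈ B, l y = 0 → v y = 0) {y : E} (hyB : y ∈ B) (hy : l y = 0) :
    (∀ h k, v'' y h k = v'' y k h) ∧ ∀ h k,
      v'' y h k = l h • v'' y ν k + l k • v'' y ν h - (l h * l k) • v'' y ν ν := by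
  have hsub : B ∩ {y | l y = 0} ⊆ B ∩ {y | 0 ≤ l y} := fun x hx => ⟨hx.1, hx.2.ge⟩
  have hsymm : ∀ h k, v'' y h k = v'' y k h := by
    refine hv.symmetric (hBc.inter (convex_halfSpace_ge l.isLinear 0)) ?_ (hsub ⟨hyB, hy⟩)
    have hopen : IsOpen (B ∩ {y | 0 < l y}) := hB.inter (isOpen_lt continuous_const l.continuous)
    have hline : ContinuousAt (fun r : ℝ => y + r • ν) 0 := by fun_prop
    have hmem : ∀ᶠ r : ℝ in 𝓝[>] 0, y + r • ν ∈ B :=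
      nhdsWithin_le_nhds (hline.preimage_mem_nhds (hB.mem_nhds (by simpa using hyB)))
    obtain ⟨r, hr, hr0⟩ := (hmem.and self_mem_nhdsWithin).exists
    refine ⟨y + r • ν, interior_maximal (t := B ∩ {y | 0 < l y}) ?_ hopen ⟨hr, ?_⟩⟩
    · exact inter_subset_inter_right B fun x (hx : 0 < l x) => hx.le
    · simpa [hy, hν] using hr0
  have htan : ∀ h k, l h = 0 → l k = 0 → v'' y h k = 0 := by
    intro h k hh hk
    have h1 := (hv.snd y (hsub ⟨hyB, hy⟩)).clm_apply (hasFDerivWithinAt_const k y _)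
    have := h1.apply_eq_of_eqOn_ker hB
      (hasFDerivWithinAt_const (0 : F) y univ) hsub (subset_univ _)
      (fun x hx => by
        simp only
        rw [hv.fst_apply_of_eq_zero hB hν hv0 hx.1 hx.2 k, hk, zero_smul]) hyB hy hh
    simpa using this
  refine ⟨hsymm, fun h k => ?_⟩
  have := htan (h - l h • ν) (k - l k • ν) (by simp [hν]) (by simp [hν])
  simp only [map_sub, map_smul, sub_apply, smul_apply] at this
  rw [hsymm h ν] at this
  rw [← sub_eq_zero, ← this]
  module

theorem C2HolderOn.quadReflection {α M N : ℝ} (hα0 : 0 < α) (hα1 : α ≤ 1) (hM : 0 ≤ M)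
    (hN : 1 ≤ N) {B₁ B₂ : Set E} (hB₁ : IsOpen B₁) (hB₁c : Convex ℝ B₁) (hB₂ : IsOpen B₂)
    (hB₂c : Convex ℝ B₂) (hB : B₂ ⊆ B₁) (hd : ∀ x ∈ B₂, ∀ y ∈ B₂, ‖x - y‖ ≤ 1)
    {v : E → ℝ} {v' : E → E →L[ℝ] ℝ} {v'' : E → E →L[ℝ] E →L[ℝ] ℝ}
    (hv : C2HolderOn α (B₁ ∩ {y | 0 ≤ l y}) v v' v'' M) {P' : E → E →L[ℝ] E}
    {P'' : E → E →L[ℝ] E →L[ℝ] E} (hP : C2HolderOn α B₂ (quadReflection l ν X q) P' P'' N)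
    (hmaps : MapsTo (quadReflection l ν X q) (B₂ ∩ {y | l y ≤ 0}) (B₁ ∩ {y | 0 ≤ l y}))
    (hν : l ν = 1) (hv0 : ∀ y ∈ B₁, l y = 0 → v y = 0)
    (hX : ∀ y ∈ B₂, l y = 0 → l (X y) = 2)
    (hbd : ∀ y ∈ B₂, l y = 0 → v'' y ν (X y) - v'' y ν ν + q y * v' y ν = 0) :
    ∃ e' e'', C2HolderOn α B₂
      (fun y => if 0 ≤ l y then v y else -v (_root_.quadReflection l ν X q y)) e' e''
      (2 * (5 * N ^ 3 * M)) := by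
  have hw := (hv.comp hα0 hα1 hN hM (hB₂c.inter (convex_halfSpace_le l.isLinear 0))
    (fun x hx y hy => hd x hx.1 y hy.1) (hP.mono inter_subset_left) hmaps).neg
  have hM' : M ≤ 5 * N ^ 3 * M := by
    have : 1 ≤ N ^ 3 := one_le_pow₀ hN
    nlinarith
  have hv₂ := (hv.mono (inter_subset_inter_left {y | 0 ≤ l y} hB)).mono_const hM'
  have hv0' : ∀ y ∈ B₂, l y = 0 → v y = 0 := fun y hy => hv0 y (hB hy)
  have h1 : ∀ y ∈ B₂, l y = 0 →
      v' y = -(v' (_root_.quadReflection l ν X q y) ∘L P' y) := by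
    intro y hyB hy
    have hPν := hP.quadReflection_fst hB₂ hν (t := 0) hy (by simpa using hyB)
    rw [quadReflection_of_apply_eq_zero hy]
    refine ContinuousLinearMap.ext_of_ker hν (fun h hh => ?_) ?_
    · have hw1 := hw.fst y ⟨hyB, hy.le⟩
      simp only [Pi.neg_apply, quadReflection_of_apply_eq_zero hy] at hw1
      exact (hv₂.fst y ⟨hyB, hy.ge⟩).apply_eq_of_eqOn_ker hB₂ hw1
        (fun x hx => ⟨hx.1, hx.2.ge⟩) (fun x hx => ⟨hx.1, hx.2.le⟩)
        (fun x hx => by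
          simp [quadReflection_of_apply_eq_zero hx.2, hv0' x hx.1 hx.2]) hyB hy hh
    · simp only [zero_smul, add_zero, mul_zero, zero_mul] at hPν
      have := hv.fst_apply_of_eq_zero hB₁ hν hv0 (hB hyB) hy (X y)
      simp only [neg_apply, ContinuousLinearMap.comp_apply, hPν, map_sub, this,
        hX y hyB hy, smul_eq_mul]
      ring
  refine ⟨_, _, C2HolderOn.ite_halfSpace hα0 (by positivity) hB₂c hv₂ hw (fun y hyB hy => ?_)
    h1 fun y hyB hy => ?_⟩
  · simp [quadReflection_of_apply_eq_zero hy, hv0' y hyB hy]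
  · obtain ⟨hsymm, hform⟩ := hv.snd_apply_of_eq_zero hB₁ hB₁c hν hv0 (hB hyB) hy
    have htan : ∀ h, l h = 0 → v'' y h =
        -compSndDeriv (v' (_root_.quadReflection l ν X q y))
          (v'' (_root_.quadReflection l ν X q y)) (P' y) (P'' y) h := by
      intro h hh
      exact (hv₂.snd y ⟨hyB, hy.ge⟩).apply_eq_of_eqOn_ker hB₂ (hw.snd y ⟨hyB, hy.le⟩)
        (fun x hx => ⟨hx.1, hx.2.ge⟩) (fun x hx => ⟨hx.1, hx.2.le⟩)
        (fun x hx => h1 x hx.1 hx.2) hyB hy hh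
    have hPsymm : ∀ h k, P'' y h k = P'' y k h :=
      hP.symmetric hB₂c ⟨y, by rwa [hB₂.interior_eq]⟩ hyB
    have hPν := hP.quadReflection_fst hB₂ hν (t := 0) hy (by simpa using hyB)
    simp only [zero_smul, add_zero, mul_zero, zero_mul] at hPν
    have hPνν := hP.quadReflection_snd hB₂ hν hyB hy
    refine ContinuousLinearMap.ext_of_ker hν htan
      (ContinuousLinearMap.ext_of_ker hν (fun h hh => ?_) ?_)
    · have := congrArg (fun f => f ν) (htan h hh)
      simp only [quadReflection_of_apply_eq_zero hy, neg_apply, Pi.neg_apply,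
        compSndDeriv_apply] at this ⊢
      rw [hsymm ν h, this, hPsymm h ν, hsymm (P' y h)]
    · simp only [quadReflection_of_apply_eq_zero hy, neg_apply, Pi.neg_apply,
        compSndDeriv_apply, hPν, hPνν, map_smul, map_sub, sub_apply]
      have h3 := hform (X y) (X y)
      have h4 := hbd y hyB hy
      rw [hX y hyB hy] at h3
      rw [hsymm (X y) ν, h3]
      simp only [smul_eq_mul]
      linarith

end Reflection

section FlattenedOperator

set_option maxSynthPendingDepth 3

variable {ι E : Type*} [Fintype ι] [NormedAddCommGroup E] [NormedSpace ℝ E]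

/-- The pointwise data of a second-order operator (its coefficients of order two and one) and of
a change of coordinates (its first two derivatives). -/
abbrev FlatData (ι E : Type*) [NormedAddCommGroup E] [NormedSpace ℝ E] : Type _ :=
  ((ι → ι → ℝ) × (ι → ℝ)) × ((E →L[ℝ] E) × (E →L[ℝ] E →L[ℝ] E))

/-- The coefficient of the second derivative transversal to the hyperplane `l = 0`, for the
operator in the new coordinates. -/
def flatLead (e : ι → E) (l : E →L[ℝ] ℝ) (d : FlatData ι E) : ℝ :=
  ∑ i, ∑ j, d.1.1 i j * (l (d.2.1 (e i)) * l (d.2.1 (e j)))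

/-- Twice the conormal vector of the operator in the new coordinates, normalized by `flatLead`. -/
def flatConormal (e : ι → E) (l : E →L[ℝ] ℝ) (d : FlatData ι E) : E :=
  (flatLead e l d)⁻¹ •
    ∑ i, ∑ j, d.1.1 i j • (l (d.2.1 (e i)) • d.2.1 (e j) + l (d.2.1 (e j)) • d.2.1 (e i))

/-- The coefficient of the first derivative transversal to the hyperplane `l = 0`, for the
operator in the new coordinates, normalized by `flatLead`. -/
def flatDrift (e : ι → E) (l : E →L[ℝ] ℝ) (d : FlatData ι E) : ℝ :=
  (flatLead e l d)⁻¹ * (∑ i, ∑ j, d.1.1 i j * l (d.2.2 (e i) (e j)) +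
    ∑ i, d.1.2 i * l (d.2.1 (e i)))

variable {e : ι → E} {l : E →L[ℝ] ℝ} {d : FlatData ι E}

theorem contDiff_flatLead : ContDiff ℝ 3 (flatLead e l) := by
  unfold flatLead
  fun_prop

theorem contDiffAt_flatConormal (hd : flatLead e l d ≠ 0) :
    ContDiffAt ℝ 3 (flatConormal e l) d := by
  have h : ContDiff ℝ 3 fun d : FlatData ι E =>
      ∑ i, ∑ j, d.1.1 i j • (l (d.2.1 (e i)) • d.2.1 (e j) + l (d.2.1 (e j)) • d.2.1 (e i)) := by
    fun_prop
  exact (contDiff_flatLead.contDiffAt.inv hd).smul h.contDiffAt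

theorem contDiffAt_flatDrift (hd : flatLead e l d ≠ 0) : ContDiffAt ℝ 3 (flatDrift e l) d := by
  have h : ContDiff ℝ 3 fun d : FlatData ι E =>
      ∑ i, ∑ j, d.1.1 i j * l (d.2.2 (e i) (e j)) + ∑ i, d.1.2 i * l (d.2.1 (e i)) := by
    fun_prop
  exact (contDiff_flatLead.contDiffAt.inv hd).mul h.contDiffAt

theorem apply_flatConormal (hd : flatLead e l d ≠ 0) : l (flatConormal e l d) = 2 := by
  have : l (∑ i, ∑ j, d.1.1 i j • (l (d.2.1 (e i)) • d.2.1 (e j) + l (d.2.1 (e j)) • d.2.1 (e i)))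
      = 2 * flatLead e l d := by
    simp only [flatLead, map_sum, map_smul, map_add, smul_eq_mul, Finset.mul_sum]
    exact Finset.sum_congr rfl fun i _ => Finset.sum_congr rfl fun j _ => by ring
  rw [flatConormal, map_smul, this, smul_eq_mul]
  field_simp

/-- The boundary condition `L u = 0` in the new coordinates, for a function vanishing on the
hyperplane `l = 0`. -/
theorem flatConormal_flatDrift_eq_zero (hd : flatLead e l d ≠ 0) {ν : E} {f₁ : E →L[ℝ] ℝ}
    {f₂ : E →L[ℝ] E →L[ℝ] ℝ} (h₁ : ∀ h, f₁ h = l h • f₁ ν)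
    (h₂ : ∀ h k, f₂ h k = l h • f₂ ν k + l k • f₂ ν h - (l h * l k) • f₂ ν ν)
    (hL : ∑ i, ∑ j, d.1.1 i j * compSndDeriv f₁ f₂ d.2.1 d.2.2 (e i) (e j) +
      ∑ i, d.1.2 i * f₁ (d.2.1 (e i)) = 0) :
    f₂ ν (flatConormal e l d) - f₂ ν ν + flatDrift e l d * f₁ ν = 0 := by
  have key : flatLead e l d * (f₂ ν (flatConormal e l d) - f₂ ν ν + flatDrift e l d * f₁ ν) =
      ∑ i, ∑ j, d.1.1 i j * compSndDeriv f₁ f₂ d.2.1 d.2.2 (e i) (e j) +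
        ∑ i, d.1.2 i * f₁ (d.2.1 (e i)) := by
    have e1 : flatLead e l d * f₂ ν (flatConormal e l d) = ∑ i, ∑ j, d.1.1 i j *
        (l (d.2.1 (e i)) * f₂ ν (d.2.1 (e j)) + l (d.2.1 (e j)) * f₂ ν (d.2.1 (e i))) := by
      rw [flatConormal, map_smul, smul_eq_mul, mul_inv_cancel_left₀ hd]
      simp only [map_sum, map_smul, map_add, smul_eq_mul]
    have e2 : flatLead e l d * flatDrift e l d =
        ∑ i, ∑ j, d.1.1 i j * l (d.2.2 (e i) (e j)) + ∑ i, d.1.2 i * l (d.2.1 (e i)) := by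
      rw [flatDrift, mul_inv_cancel_left₀ hd]
    have e3 : flatLead e l d * (f₂ ν (flatConormal e l d) - f₂ ν ν + flatDrift e l d * f₁ ν) =
        flatLead e l d * f₂ ν (flatConormal e l d) - flatLead e l d * f₂ ν ν +
          (flatLead e l d * flatDrift e l d) * f₁ ν := by ring
    have e4 : ∀ i, f₁ (d.2.1 (e i)) = l (d.2.1 (e i)) * f₁ ν := fun i => h₁ _
    have e5 : ∀ i j, compSndDeriv f₁ f₂ d.2.1 d.2.2 (e i) (e j) =
        (l (d.2.1 (e i)) * f₂ ν (d.2.1 (e j)) + l (d.2.1 (e j)) * f₂ ν (d.2.1 (e i))) -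
          (l (d.2.1 (e i)) * l (d.2.1 (e j))) * f₂ ν ν + l (d.2.2 (e i) (e j)) * f₁ ν := by
      intro i j
      rw [compSndDeriv_apply, h₁, h₂]
      simp only [smul_eq_mul]
      ring
    rw [e3, e1, e2, flatLead]
    simp only [e4, e5, mul_add, mul_sub, add_mul, Finset.sum_add_distrib, Finset.sum_sub_distrib,
      Finset.sum_mul, mul_assoc]
    ring
  rw [hL] at key
  exact (mul_eq_zero.1 key).resolve_left hd

end FlattenedOperator

section BoundaryChart

set_option maxSynthPendingDepth 3

variable {E : Type*} [NormedAddCommGroup E] [NormedSpace ℝ E]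

/-- `Ψ : U → V` is a diffeomorphism of class `C^{4,α}`, with inverse `Φ` of class `C⁴`, mapping
`Ω` and `∂Ω` to the half-space `0 < l` and the hyperplane `l = 0`. -/
structure IsBoundaryChart (α : ℝ≥0) (Ω U V : Set E) (Ψ Φ : E → E) (l : E →L[ℝ] ℝ) : Prop where
  isOpen_source : IsOpen U
  isOpen_target : IsOpen V
  mapsTo : MapsTo Ψ U V
  mapsTo_symm : MapsTo Φ V U
  left_inv : ∀ x ∈ U, Φ (Ψ x) = x
  right_inv : ∀ y ∈ V, Ψ (Φ y) = y
  contDiffOn : ContDiffOn ℝ 4 Ψ U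
  holder : ∃ C : ℝ≥0, HolderOnWith C α (iteratedFDerivWithin ℝ 4 Ψ U) U
  contDiffOn_symm : ContDiffOn ℝ 4 Φ V
  mem_iff : ∀ x ∈ U, (x ∈ Ω ↔ 0 < l (Ψ x))
  mem_frontier_iff : ∀ x ∈ U, (x ∈ frontier Ω ↔ l (Ψ x) = 0)

namespace IsBoundaryChart

variable {α : ℝ≥0} {Ω U V : Set E} {Ψ Φ : E → E} {l : E →L[ℝ] ℝ}

theorem mem_closure_iff (h : IsBoundaryChart α Ω U V Ψ Φ l) (hΩ : IsOpen Ω) {x : E} (hx : x ∈ U) :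
    x ∈ closure Ω ↔ 0 ≤ l (Ψ x) := by
  rw [closure_eq_interior_union_frontier, hΩ.interior_eq, mem_union, h.mem_iff x hx,
    h.mem_frontier_iff x hx, le_iff_lt_or_eq, eq_comm (a := (0 : ℝ))]

theorem symm_mem_closure_iff (h : IsBoundaryChart α Ω U V Ψ Φ l) (hΩ : IsOpen Ω) {y : E}
    (hy : y ∈ V) : Φ y ∈ closure Ω ↔ 0 ≤ l y := by
  rw [h.mem_closure_iff hΩ (h.mapsTo_symm hy), h.right_inv y hy]

theorem symm_mem_frontier_iff (h : IsBoundaryChart α Ω U V Ψ Φ l) {y : E} (hy : y ∈ V) :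
    Φ y ∈ frontier Ω ↔ l y = 0 := by
  rw [h.mem_frontier_iff _ (h.mapsTo_symm hy), h.right_inv y hy]

theorem hasTwoFDerivsOn (h : IsBoundaryChart α Ω U V Ψ Φ l) :
    HasTwoFDerivsOn U Ψ (fderivWithin ℝ Ψ U) (fderivWithin ℝ (fderivWithin ℝ Ψ U) U) :=
  (h.contDiffOn.of_le (by norm_num)).hasTwoFDerivsOn h.isOpen_source.uniqueDiffOn

theorem contDiffAt (h : IsBoundaryChart α Ω U V Ψ Φ l) {x : E} (hx : x ∈ U) :
    ContDiffAt ℝ 3 Ψ x :=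
  (h.contDiffOn.contDiffAt (h.isOpen_source.mem_nhds hx)).of_le (by norm_num)

theorem contDiffAt_symm (h : IsBoundaryChart α Ω U V Ψ Φ l) {y : E} (hy : y ∈ V) :
    ContDiffAt ℝ 3 Φ y :=
  (h.contDiffOn_symm.contDiffAt (h.isOpen_target.mem_nhds hy)).of_le (by norm_num)

theorem hasFDerivAt (h : IsBoundaryChart α Ω U V Ψ Φ l) {x : E} (hx : x ∈ U) :
    HasFDerivAt Ψ (fderivWithin ℝ Ψ U x) x :=
  (h.hasTwoFDerivsOn.fst x hx).hasFDerivAt (h.isOpen_source.mem_nhds hx)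

theorem hasFDerivAt_symm (h : IsBoundaryChart α Ω U V Ψ Φ l) {y : E} (hy : y ∈ V) :
    HasFDerivAt Φ (fderiv ℝ Φ y) y :=
  ((h.contDiffAt_symm hy).differentiableAt (by norm_num)).hasFDerivAt

theorem fderiv_apply_fderiv_symm (h : IsBoundaryChart α Ω U V Ψ Φ l) {x : E} (hx : x ∈ U) (k : E) :
    fderivWithin ℝ Ψ U x (fderiv ℝ Φ (Ψ x) k) = k := by
  have h0 : HasFDerivAt Ψ (fderivWithin ℝ Ψ U x) (Φ (Ψ x)) := by
    rw [h.left_inv x hx]; exact h.hasFDerivAt hx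
  have h1 := h0.comp (Ψ x) (h.hasFDerivAt_symm (h.mapsTo hx))
  have h2 : HasFDerivAt (Ψ ∘ Φ) (ContinuousLinearMap.id ℝ E) (Ψ x) :=
    (hasFDerivAt_id (Ψ x)).congr_of_eventuallyEq
      (Filter.eventuallyEq_of_mem (h.isOpen_target.mem_nhds (h.mapsTo hx)) h.right_inv)
  exact congrArg (fun f => f k) (h1.unique h2)

theorem fderiv_symm_apply_fderiv (h : IsBoundaryChart α Ω U V Ψ Φ l) {x : E} (hx : x ∈ U) (k : E) :
    fderiv ℝ Φ (Ψ x) (fderivWithin ℝ Ψ U x k) = k := by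
  have h1 := (h.hasFDerivAt_symm (h.mapsTo hx)).comp x (h.hasFDerivAt hx)
  have h2 : HasFDerivAt (Φ ∘ Ψ) (ContinuousLinearMap.id ℝ E) x :=
    (hasFDerivAt_id x).congr_of_eventuallyEq
      (Filter.eventuallyEq_of_mem (h.isOpen_source.mem_nhds hx) h.left_inv)
  exact congrArg (fun f => f k) (h1.unique h2)

theorem uniqueDiffWithinAt_closure (h : IsBoundaryChart α Ω U V Ψ Φ l) (hΩ : IsOpen Ω) {ν : E}
    (hν : l ν = 1) {x : E} (hx : x ∈ U) (hxΩ : x ∈ closure Ω) :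
    UniqueDiffWithinAt ℝ (closure Ω) x := by
  have hy : Ψ x ∈ V := h.mapsTo hx
  have hH : UniqueDiffWithinAt ℝ ({y | 0 ≤ l y} ∩ V) (Ψ x) := by
    refine UniqueDiffWithinAt.inter ?_ (h.isOpen_target.mem_nhds hy)
    refine uniqueDiffOn_convex (convex_halfSpace_ge l.isLinear 0) ⟨ν, ?_⟩ (Ψ x)
      ((h.mem_closure_iff hΩ hx).1 hxΩ)
    refine interior_maximal (t := {y | 0 < l y}) (fun y (hy : 0 < l y) => hy.le)
      (isOpen_lt continuous_const l.continuous) ?_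
    simp [hν]
  have hd := (h.hasFDerivAt_symm hy).hasFDerivWithinAt (s := {y | 0 ≤ l y} ∩ V)
  have := hd.uniqueDiffWithinAt hH
    (Function.Surjective.denseRange fun k => ⟨_, h.fderiv_symm_apply_fderiv hx k⟩)
  rw [h.left_inv x hx] at this
  refine this.mono ?_
  rintro _ ⟨y, hy, rfl⟩
  exact (h.symm_mem_closure_iff hΩ hy.2).2 hy.1

end IsBoundaryChart

end BoundaryChart

section BoundaryExtension

set_option maxSynthPendingDepth 3

variable {ι E : Type*} [Fintype ι] [NormedAddCommGroup E] [NormedSpace ℝ E]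

/-- The data, at the point `x`, of the operator with coefficients `a`, `b` and of the change of
coordinates `Ψ`. -/
def flatData (a : ι → ι → E → ℝ) (b : ι → E → ℝ) (U : Set E) (Ψ : E → E) (x : E) :
    FlatData ι E :=
  ((fun i j => a i j x, fun i => b i x),
    (fderivWithin ℝ Ψ U x, fderivWithin ℝ (fderivWithin ℝ Ψ U) U x))

namespace IsBoundaryChart

variable {α : ℝ≥0} {Ω U V : Set E} {Ψ Φ : E → E} {l : E →L[ℝ] ℝ} {a : ι → ι → E → ℝ}
  {b : ι → E → ℝ} {e : ι → E} {ν : E}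

theorem flatLead_ne_zero (h : IsBoundaryChart α Ω U V Ψ Φ l) (hν : l ν = 1)
    (hell : ∀ x ∈ closure Ω, ∀ φ : E →L[ℝ] ℝ, φ ≠ 0 →
      0 < ∑ i, ∑ j, a i j x * (φ (e i) * φ (e j)))
    {x : E} (hx : x ∈ U) (hxΩ : x ∈ closure Ω) : flatLead e l (flatData a b U Ψ x) ≠ 0 := by
  refine (hell x hxΩ (l ∘L fderivWithin ℝ Ψ U x) fun h0 => ?_).ne'
  have := congrArg (fun f => f (fderiv ℝ Φ (Ψ x) ν)) h0
  simp [h.fderiv_apply_fderiv_symm hx, hν] at this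

theorem c2HolderAt_fderivWithin_two (h : IsBoundaryChart α Ω U V Ψ Φ l) {x : E} (hx : x ∈ U) :
    C2HolderAt α U x (fderivWithin ℝ (fderivWithin ℝ Ψ U) U) := by
  have hu := h.isOpen_source.uniqueDiffOn (𝕜 := ℝ)
  obtain ⟨C, hC⟩ := h.holder
  rw [holderOnWith_iteratedFDerivWithin_succ hu 3, holderOnWith_iteratedFDerivWithin_succ hu 2] at hC
  have h1 : ContDiffOn ℝ 3 (fderivWithin ℝ Ψ U) U := h.contDiffOn.fderivWithin hu (by norm_num)
  exact C2HolderAt.of_holderOnWith hu (h1.fderivWithin hu (by norm_num)) hC hx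

theorem c2HolderAt_flatData [DecidableEq ι] (h : IsBoundaryChart α Ω U V Ψ Φ l) (hΩ : IsOpen Ω)
    (hα0 : 0 < α) (hα1 : α ≤ 1) (hν : l ν = 1)
    (ha : ∀ x ∈ closure Ω, ∀ i j, C2HolderAt α (closure Ω) x (a i j))
    (hb : ∀ x ∈ closure Ω, ∀ i, C2HolderAt α (closure Ω) x (b i))
    {y : E} (hyV : y ∈ V) (hy : l y = 0) :
    C2HolderAt α univ y (flatData a b U Ψ ∘ Φ ∘ kerProj l ν) := by
  have hα0' : (0 : ℝ) < α := hα0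
  have hα1' : (α : ℝ) ≤ 1 := hα1
  have hp : kerProj l ν y = y := kerProj_of_apply_eq_zero hy
  have hΦy : Φ y ∈ U := h.mapsTo_symm hyV
  have hΦyΩ : Φ y ∈ closure Ω := (h.symm_mem_closure_iff hΩ hyV).2 hy.ge
  have hpc : ContinuousAt (kerProj l ν) y := contDiff_kerProj.continuous.continuousAt
  have hev : ∀ᶠ w in 𝓝 y, kerProj l ν w ∈ V :=
    hpc.preimage_mem_nhds (by rw [hp]; exact h.isOpen_target.mem_nhds hyV)
  have hΦp : C2HolderAt α univ y (Φ ∘ kerProj l ν) :=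
    (C2HolderAt.of_contDiffAt hα1' contDiff_kerProj.contDiffAt).contDiffAt_comp hα0' hα1'
      convex_univ trivial (by rw [hp]; exact h.contDiffAt_symm hyV)
  have hval : (Φ ∘ kerProj l ν) y = Φ y := by simp [hp]
  have hevΩ : ∀ᶠ w in 𝓝[univ] y, (Φ ∘ kerProj l ν) w ∈ closure Ω := by
    rw [nhdsWithin_univ]
    exact hev.mono fun w hw => (h.symm_mem_closure_iff hΩ hw).2 (apply_kerProj hν w).ge
  have hevU : ∀ᶠ w in 𝓝[univ] y, (Φ ∘ kerProj l ν) w ∈ U := by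
    rw [nhdsWithin_univ]
    exact hev.mono fun w hw => h.mapsTo_symm hw
  have hA : ∀ i j, C2HolderAt α univ y (a i j ∘ (Φ ∘ kerProj l ν)) := fun i j =>
    C2HolderAt.comp hα0' hα1' convex_univ trivial (by rw [hval]; exact ha _ hΦyΩ i j) hΦp hevΩ
  have hB : ∀ i, C2HolderAt α univ y (b i ∘ (Φ ∘ kerProj l ν)) := fun i =>
    C2HolderAt.comp hα0' hα1' convex_univ trivial (by rw [hval]; exact hb _ hΦyΩ i) hΦp hevΩ
  have hT : C2HolderAt α univ y (fderivWithin ℝ Ψ U ∘ (Φ ∘ kerProj l ν)) := by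
    refine hΦp.contDiffAt_comp hα0' hα1' convex_univ trivial ?_
    rw [hval]
    exact (h.contDiffOn.fderivWithin h.isOpen_source.uniqueDiffOn (by norm_num)).contDiffAt
      (h.isOpen_source.mem_nhds hΦy)
  have hS : C2HolderAt α univ y
      (fderivWithin ℝ (fderivWithin ℝ Ψ U) U ∘ (Φ ∘ kerProj l ν)) :=
    C2HolderAt.comp hα0' hα1' convex_univ trivial
      (by rw [hval]; exact h.c2HolderAt_fderivWithin_two hΦy) hΦp hevU
  exact ((C2HolderAt.pi hα0' hα1' convex_univ trivial fun i =>
    C2HolderAt.pi hα0' hα1' convex_univ trivial fun j => hA i j).prodMk hα0' hα1' convex_univ trivial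
      (C2HolderAt.pi hα0' hα1' convex_univ trivial hB)).prodMk hα0' hα1' convex_univ trivial
    (hT.prodMk hα0' hα1' convex_univ trivial hS)

theorem exists_extension [DecidableEq ι] (h : IsBoundaryChart α Ω U V Ψ Φ l) (hΩ : IsOpen Ω)
    (huniq : UniqueDiffOn ℝ (closure Ω))
    (hα0 : 0 < α) (hα1 : α ≤ 1) (hν : l ν = 1)
    (ha : ∀ x ∈ closure Ω, ∀ i j, C2HolderAt α (closure Ω) x (a i j))
    (hb : ∀ x ∈ closure Ω, ∀ i, C2HolderAt α (closure Ω) x (b i))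
    (hell : ∀ x ∈ closure Ω, ∀ φ : E →L[ℝ] ℝ, φ ≠ 0 →
      0 < ∑ i, ∑ j, a i j x * (φ (e i) * φ (e j)))
    {z : E} (hzU : z ∈ U) (hz : z ∈ frontier Ω) :
    ∃ (r : ℝ) (R : E → E) (K : ℝ), 0 < r ∧ r ≤ 1 / 2 ∧ 0 ≤ K ∧
      (∀ x ∈ ball z r, x ∉ closure Ω → R x ∈ closure Ω) ∧
      ∀ (u : E → ℝ) (u' : E → E →L[ℝ] ℝ) (u'' : E → E →L[ℝ] E →L[ℝ] ℝ) (M : ℝ), 0 ≤ M →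
        C2HolderOn α (closure Ω) u u' u'' M → (∀ x ∈ frontier Ω, u x = 0) →
        (∀ x ∈ frontier Ω,
          ∑ i, ∑ j, a i j x * u'' x (e i) (e j) + ∑ i, b i x * u' x (e i) = 0) →
        ∃ f' f'', C2HolderOn α (ball z r)
          (fun x => open Classical in if x ∈ closure Ω then u x else -u (R x)) f' f'' (K * M) := by
  have hα0' : (0 : ℝ) < α := hα0
  have hα1' : (α : ℝ) ≤ 1 := hα1
  set y₀ := Ψ z with hy₀
  have hyV : y₀ ∈ V := h.mapsTo hzU
  have hly : l y₀ = 0 := (h.mem_frontier_iff z hzU).1 hz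
  set X : E → E := fun y => flatConormal e l (flatData a b U Ψ (Φ y)) with hX
  set q : E → ℝ := fun y => flatDrift e l (flatData a b U Ψ (Φ y)) with hq
  have hp : kerProj l ν y₀ = y₀ := kerProj_of_apply_eq_zero hly
  have hne : ∀ y ∈ V, l y = 0 → flatLead e l (flatData a b U Ψ (Φ y)) ≠ 0 := fun y hy hly =>
    h.flatLead_ne_zero hν hell (h.mapsTo_symm hy) ((h.symm_mem_closure_iff hΩ hy).2 hly.ge)
  have hD := h.c2HolderAt_flatData hΩ hα0 hα1 hν ha hb hyV hly
  have hDval : (flatData a b U Ψ ∘ Φ ∘ kerProj l ν) y₀ = flatData a b U Ψ (Φ y₀) := by simp [hp]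
  have hP : C2HolderAt α univ y₀ (quadReflection l ν X q) := by
    have hid : C2HolderAt (α : ℝ) univ y₀ (id : E → E) :=
      C2HolderAt.of_contDiffAt hα1' contDiffAt_id
    refine (hid.prodMk hα0' hα1' convex_univ trivial hD).contDiffAt_comp hα0' hα1' convex_univ
      trivial (g := fun p : E × FlatData ι E => p.1 - l p.1 • flatConormal e l p.2 +
        (l p.1 ^ 2 * flatDrift e l p.2) • ν) ?_
    have h1 : ContDiffAt ℝ 3 (fun p : E × FlatData ι E => flatConormal e l p.2)
        (y₀, flatData a b U Ψ (Φ y₀)) :=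
      ContDiffAt.comp (f := Prod.snd) (y₀, flatData a b U Ψ (Φ y₀))
        (contDiffAt_flatConormal (hne y₀ hyV hly)) contDiffAt_snd
    have h2 : ContDiffAt ℝ 3 (fun p : E × FlatData ι E => flatDrift e l p.2)
        (y₀, flatData a b U Ψ (Φ y₀)) :=
      ContDiffAt.comp (f := Prod.snd) (y₀, flatData a b U Ψ (Φ y₀))
        (contDiffAt_flatDrift (hne y₀ hyV hly)) contDiffAt_snd
    simp only [id, hDval]
    fun_prop
  have hqc : ContinuousAt (fun y => l y * q (kerProj l ν y)) y₀ := by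
    have h2 : ContinuousAt (fun y => q (kerProj l ν y)) y₀ := by
      have : ContinuousAt (flatDrift e l) ((flatData a b U Ψ ∘ Φ ∘ kerProj l ν) y₀) := by
        rw [hDval]; exact (contDiffAt_flatDrift (hne y₀ hyV hly)).continuousAt
      exact this.comp (by simpa [continuousWithinAt_univ] using hD.continuousWithinAt trivial)
    exact l.continuous.continuousAt.mul h2
  have hPc : ContinuousAt (quadReflection l ν X q) y₀ := by
    simpa [continuousWithinAt_univ] using hP.continuousWithinAt trivial
  obtain ⟨r₁, hr₁, hr₁2, hr₁V, Φ', Φ'', N₁, hN₁, hΦ⟩ :=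
    (C2HolderAt.of_contDiffAt hα1' (h.contDiffAt_symm hyV)).exists_ball
      (h.isOpen_target.mem_nhds hyV)
  have hPy : quadReflection l ν X q y₀ = y₀ := quadReflection_of_apply_eq_zero hly
  have hO : ball y₀ r₁ ∩ (quadReflection l ν X q ⁻¹' ball y₀ r₁ ∩ kerProj l ν ⁻¹' ball y₀ r₁ ∩
      {y | l y * q (kerProj l ν y) < 1}) ∈ 𝓝 y₀ := by
    refine Filter.inter_mem (ball_mem_nhds _ hr₁) (Filter.inter_mem (Filter.inter_mem ?_ ?_) ?_)
    · exact hPc.preimage_mem_nhds (by rw [hPy]; exact ball_mem_nhds _ hr₁)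
    · exact contDiff_kerProj.continuous.continuousAt.preimage_mem_nhds
        (by rw [hp]; exact ball_mem_nhds _ hr₁)
    · exact hqc.eventually_lt_const (by simp [hly])
  obtain ⟨r₂, hr₂, hr₂2, hr₂O, P', P'', N₂, hN₂, hP⟩ := hP.exists_ball hO
  rw [inter_univ] at hP hΦ
  have hmaps : MapsTo (quadReflection l ν X q) (ball y₀ r₂ ∩ {y | l y ≤ 0})
      (ball y₀ r₁ ∩ {y | 0 ≤ l y}) := by
    rintro y ⟨hy, hly : l y ≤ 0⟩
    obtain ⟨-, ⟨hPy, hpy⟩, hqy : l y * q (kerProj l ν y) < 1⟩ := hr₂O hy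
    refine ⟨hPy, ?_⟩
    have h0 : l (kerProj l ν y) = 0 := apply_kerProj hν y
    change 0 ≤ l (quadReflection l ν X q y)
    rw [apply_quadReflection hν (apply_flatConormal (hne _ (hr₁V hpy) h0))]
    nlinarith
  have hΨc : ContinuousAt Ψ z := (h.contDiffAt hzU).continuousAt
  obtain ⟨r₃, hr₃, hr₃2, hr₃O, Ψ', Ψ'', N₃, hN₃, hΨ⟩ :=
    (C2HolderAt.of_contDiffAt hα1' (h.contDiffAt hzU)).exists_ball
      (Filter.inter_mem (h.isOpen_source.mem_nhds hzU)
        (hΨc.preimage_mem_nhds (ball_mem_nhds y₀ hr₂)))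
  rw [inter_univ] at hΨ
  have hΦmaps : MapsTo Φ (ball y₀ r₁ ∩ {y | 0 ≤ l y}) (closure Ω) := fun y hy =>
    (h.symm_mem_closure_iff hΩ (hr₁V hy.1)).2 hy.2
  have hdist : ∀ {w : E} {r : ℝ}, r ≤ 1 / 2 → ∀ x ∈ ball w r, ∀ y ∈ ball w r, ‖x - y‖ ≤ 1 :=
    fun hr x hx y hy => norm_sub_le_one_of_mem_ball hr univ x ⟨hx, trivial⟩ y ⟨hy, trivial⟩
  refine ⟨r₃, Φ ∘ quadReflection l ν X q ∘ Ψ, 5 * N₃ ^ 3 * (2 * (5 * N₂ ^ 3 * (5 * N₁ ^ 3))),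
    hr₃, hr₃2, by positivity, fun x hx hxΩ => ?_, fun u u' u'' M hM hu hu0 hLu => ?_⟩
  · obtain ⟨hxU, hx2⟩ := hr₃O hx
    rw [h.mem_closure_iff hΩ hxU, not_le] at hxΩ
    exact hΦmaps (hmaps ⟨hx2, hxΩ.le⟩)
  have hv := hu.comp hα0' hα1' hN₁ hM
    ((convex_ball y₀ r₁).inter (convex_halfSpace_ge l.isLinear 0))
    (fun x hx y hy => hdist hr₁2 x hx.1 y hy.1) (hΦ.mono inter_subset_left) hΦmaps
  have hv0 : ∀ y ∈ ball y₀ r₁, l y = 0 → (u ∘ Φ) y = 0 := fun y hy hly =>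
    hu0 _ ((h.symm_mem_frontier_iff (hr₁V hy)).2 hly)
  have key := hv.quadReflection hα0' hα1' (by positivity) hN₂ isOpen_ball
    (convex_ball _ _) isOpen_ball (convex_ball _ _) (fun y hy => (hr₂O hy).1) (hdist hr₂2) hP hmaps
    hν hv0 (fun y hy hly => apply_flatConormal (hne y (hr₁V (hr₂O hy).1) hly))
  obtain ⟨g', g'', hg⟩ := key fun y hy hly => by
    have hy₁ : y ∈ ball y₀ r₁ := (hr₂O hy).1
    have hyV' := hr₁V hy₁
    set x := Φ y with hx
    have hxU : x ∈ U := h.mapsTo_symm hyV'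
    have hΨx : Ψ x = y := h.right_inv y hyV'
    have hxF : x ∈ frontier Ω := (h.symm_mem_frontier_iff hyV').2 hly
    set O : Set E := U ∩ Ψ ⁻¹' ball y₀ r₁
    have hOopen : IsOpen O := h.contDiffOn.continuousOn.isOpen_inter_preimage h.isOpen_source
      isOpen_ball
    have hxW : x ∈ closure Ω ∩ O :=
      ⟨frontier_subset_closure hxF, hxU, by rw [mem_preimage, hΨx]; exact hy₁⟩
    have hW : UniqueDiffOn ℝ (closure Ω ∩ O) := huniq.inter hOopen
    have h1 := (hv.toHasTwoFDerivsOn.comp (h.hasTwoFDerivsOn.mono (t := closure Ω ∩ O)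
      fun w hw => hw.2.1) fun w hw => ⟨hw.2.2, (h.mem_closure_iff hΩ hw.2.1).1 hw.1⟩).congr
      (g := u) fun w hw => by simp [h.left_inv w hw.2.1]
    have h2 := hu.toHasTwoFDerivsOn.mono (t := closure Ω ∩ O) inter_subset_left
    have e1 := h2.fst_unique h1 hW hxW
    have e2 := h2.snd_unique h1 hW hxW
    beta_reduce at e1 e2
    rw [hΨx] at e1 e2
    have hL := hLu x hxF
    rw [e1, e2] at hL
    exact flatConormal_flatDrift_eq_zero (hne y hyV' hly)
      (hv.fst_apply_of_eq_zero isOpen_ball hν hv0 hy₁ hly)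
      (hv.snd_apply_of_eq_zero isOpen_ball (convex_ball _ _) hν hv0 hy₁ hly).2 hL
  refine ⟨_, _, ((hg.comp hα0' hα1' hN₃ (by positivity) (convex_ball _ _) (hdist hr₃2) hΨ
    (fun x hx => (hr₃O hx).2)).congr fun x hx => ?_).mono_const (by apply le_of_eq; ring)⟩
  have hxU := (hr₃O hx).1
  simp only [Function.comp_apply, h.mem_closure_iff hΩ hxU, h.left_inv x hxU]

end IsBoundaryChart

end BoundaryExtension

section Globalization

set_option maxSynthPendingDepth 3

variable {E : Type*} [NormedAddCommGroup E] [NormedSpace ℝ E]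

open scoped Manifold ContDiff in
/-- Smooth cutoff functions on a compact set, subordinate to a family of balls around its
points. -/
theorem IsCompact.exists_cutoffs [FiniteDimensional ℝ E] {S : Set E} (hS : IsCompact S)
    {r : E → ℝ} (hr : ∀ z ∈ S, 0 < r z) :
    ∃ (t : Finset E) (χ : E → E → ℝ), (∀ z ∈ t, z ∈ S) ∧ (∀ z ∈ t, ContDiff ℝ 3 (χ z)) ∧
      (∀ z ∈ t, HasCompactSupport (χ z)) ∧ (∀ z ∈ t, tsupport (χ z) ⊆ ball z (r z)) ∧
      (∀ z x, 0 ≤ χ z x) ∧ (∀ x ∈ S, ∑ z ∈ t, χ z x = 1) ∧ ∀ x, ∑ z ∈ t, χ z x ≤ 1 := by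
  classical
  obtain ⟨t, htS, hcov⟩ := hS.elim_nhds_subcover (fun z => ball z (r z))
    fun z hz => ball_mem_nhds z (hr z hz)
  obtain ⟨f, hf⟩ := SmoothPartitionOfUnity.exists_isSubordinate 𝓘(ℝ, E) hS.isClosed
    (fun z : t => ball z.1 (r z)) (fun _ => isOpen_ball) (by
      intro x hx
      obtain ⟨z, hz, hxz⟩ := mem_iUnion₂.1 (hcov hx)
      exact mem_iUnion.2 ⟨⟨z, hz⟩, hxz⟩)
  let χ : E → E → ℝ := fun z x => if hz : z ∈ t then f ⟨z, hz⟩ x else 0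
  have hχ : ∀ z (hz : z ∈ t), χ z = f ⟨z, hz⟩ := fun z hz => funext fun x => dif_pos hz
  have hsum : ∀ x, ∑ z ∈ t, χ z x = ∑ᶠ z : t, f z x := by
    intro x
    rw [finsum_eq_sum_of_fintype, ← Finset.sum_coe_sort]
    exact Finset.sum_congr rfl fun z _ => congrFun (hχ z z.2) x
  refine ⟨t, χ, htS, fun z hz => ?_, fun z hz => ?_, fun z hz => ?_, fun z x => ?_, fun x hx => ?_,
    fun x => ?_⟩
  · rw [hχ z hz]
    exact contDiff_infty.1 (f ⟨z, hz⟩).contMDiff.contDiff 3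
  · rw [hχ z hz]
    exact (isCompact_closedBall z (r z)).of_isClosed_subset (isClosed_tsupport _)
      ((hf ⟨z, hz⟩).trans ball_subset_closedBall)
  · rw [hχ z hz]
    exact hf ⟨z, hz⟩
  · by_cases hz : z ∈ t
    · rw [hχ z hz]
      exact f.nonneg _ x
    · simp [χ, hz]
  · rw [hsum, f.sum_eq_one hx]
  · rw [hsum]
    exact f.sum_le_one x

open Classical in
/-- Local extensions obtained by odd reflections patch together to a global extension. -/
theorem exists_global_extension [FiniteDimensional ℝ E] {S : Set E} (hS : IsCompact S) {α : ℝ}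
    (hα0 : 0 < α) (hα1 : α ≤ 1) {D : Set (E → ℝ)}
    (hloc : ∀ z ∈ S, ∃ (r : ℝ) (R : E → E) (K : ℝ), 0 < r ∧ r ≤ 1 / 2 ∧ 0 ≤ K ∧
      (∀ x ∈ ball z r, x ∉ S → R x ∈ S) ∧
      ∀ u ∈ D, ∀ (u' : E → E →L[ℝ] ℝ) (u'' : E → E →L[ℝ] E →L[ℝ] ℝ) (M : ℝ), 0 ≤ M →
        C2HolderOn α S u u' u'' M → ∃ f' f'', C2HolderOn α (ball z r)
          (fun x => if x ∈ S then u x else -u (R x)) f' f'' (K * M)) :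
    ∃ (T : (E → ℝ) →ₗ[ℝ] (E → ℝ)) (K : ℝ≥0), ∀ u, EqOn (T u) u S ∧ HasCompactSupport (T u) ∧
      (∀ C : ℝ, 0 ≤ C → (∀ x ∈ S, |u x| ≤ C) → ∀ x, |T u x| ≤ C) ∧
      (u ∈ D → ∀ (u' : E → E →L[ℝ] ℝ) (u'' : E → E →L[ℝ] E →L[ℝ] ℝ) (M : ℝ), 0 ≤ M →
        C2HolderOn α S u u' u'' M → ∃ f' f'', C2HolderOn α univ (T u) f' f'' (K * M)) := by
  choose! r R K hr hr2 hK hR hext using hloc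
  obtain ⟨t, χ, htS, hχ, hχc, hχr, hχ0, hχS, hχ1⟩ := hS.exists_cutoffs hr
  have hcut := fun z (hz : z ∈ t) => exists_C2HolderOn_cutoff_mul hα0 hα1 (hr2 z (htS z hz))
    (hχ z hz) (hχc z hz) (hχr z hz)
  choose! J hJ hcut using hcut
  let T : (E → ℝ) →ₗ[ℝ] (E → ℝ) :=
    { toFun := fun u => ∑ z ∈ t, fun x => χ z x * if x ∈ S then u x else -u (R z x)
      map_add' := fun u v => by
        ext x
        simp only [Finset.sum_apply, Pi.add_apply, ← Finset.sum_add_distrib]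
        refine Finset.sum_congr rfl fun z _ => ?_
        split_ifs <;> ring
      map_smul' := fun c u => by
        ext x
        simp only [Finset.sum_apply, Pi.smul_apply, smul_eq_mul, RingHom.id_apply, Finset.mul_sum]
        refine Finset.sum_congr rfl fun z _ => ?_
        split_ifs <;> ring }
  have hT : ∀ u, T u = ∑ z ∈ t, fun x => χ z x * if x ∈ S then u x else -u (R z x) := fun _ => rfl
  refine ⟨T, ⟨∑ z ∈ t, J z * K z, Finset.sum_nonneg fun z hz =>
    mul_nonneg (hJ z hz) (hK z (htS z hz))⟩, fun u => ⟨fun x hx => ?_, ?_, fun C hC hu x => ?_,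
      fun hu u' u'' M hM h => ?_⟩⟩
  · simp [hT, hx, ← Finset.sum_mul, hχS x hx]
  · refine HasCompactSupport.intro (K := ⋃ z ∈ t, tsupport (χ z))
      (t.isCompact_biUnion fun z hz => hχc z hz) fun x hx => ?_
    rw [hT, Finset.sum_apply]
    refine Finset.sum_eq_zero fun z hz => ?_
    have : χ z x = 0 := image_eq_zero_of_notMem_tsupport fun h => hx (mem_biUnion hz h)
    simp [this]
  · rw [hT, Finset.sum_apply]
    have hterm : ∀ z ∈ t, |χ z x * if x ∈ S then u x else -u (R z x)| ≤ χ z x * C := by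
      intro z hz
      rcases (hχ0 z x).eq_or_lt with h0 | h0
      · simp [← h0]
      rw [abs_mul, abs_of_pos h0]
      refine mul_le_mul_of_nonneg_left ?_ h0.le
      split_ifs with hx
      · exact hu x hx
      · rw [abs_neg]
        exact hu _ (hR z (htS z hz) x (hχr z hz (subset_tsupport _ h0.ne')) hx)
    calc _ ≤ ∑ z ∈ t, |χ z x * if x ∈ S then u x else -u (R z x)| := Finset.abs_sum_le_sum_abs _ _
      _ ≤ ∑ z ∈ t, χ z x * C := Finset.sum_le_sum hterm
      _ = (∑ z ∈ t, χ z x) * C := (Finset.sum_mul ..).symm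
      _ ≤ C := mul_le_of_le_one_left hC (hχ1 x)
  · have hz : ∀ z ∈ t, ∃ f' f'', C2HolderOn α univ
        (fun x => χ z x * if x ∈ S then u x else -u (R z x)) f' f'' (J z * (K z * M)) := by
      intro z hz
      obtain ⟨g', g'', hg⟩ := hext z (htS z hz) u hu u' u'' M hM h
      exact hcut z hz _ g' g'' _ (mul_nonneg (hK z (htS z hz)) hM) hg
    choose! f' f'' hf using hz
    refine ⟨_, _, (C2HolderOn.sum t hf).mono_const (le_of_eq ?_)⟩
    change _ = (∑ z ∈ t, J z * K z) * M
    rw [Finset.sum_mul]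
    exact Finset.sum_congr rfl fun z _ => (mul_assoc _ _ _).symm

end Globalization

section EuclideanDomain

variable {n : ℕ} {Ω : Set (EuclideanSpace ℝ (Fin n))} {α : ℝ≥0}
  {a : Fin n → Fin n → EuclideanSpace ℝ (Fin n) → ℝ} {b : Fin n → EuclideanSpace ℝ (Fin n) → ℝ}
  {c u : EuclideanSpace ℝ (Fin n) → ℝ}

theorem SmoothBoundary.exists_isBoundaryChart (h : SmoothBoundary 4 α Ω)
    {z : EuclideanSpace ℝ (Fin n)} (hz : z ∈ frontier Ω) :
    ∃ (U V : Set (EuclideanSpace ℝ (Fin n)))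
      (Ψ Φ : EuclideanSpace ℝ (Fin n) → EuclideanSpace ℝ (Fin n))
      (l : EuclideanSpace ℝ (Fin n) →L[ℝ] ℝ) (ν : EuclideanSpace ℝ (Fin n)),
      IsBoundaryChart α Ω U V Ψ Φ l ∧ l ν = 1 ∧ z ∈ U := by
  obtain ⟨U, V, Ψ, Φ, i₀, hU, hV, hzU, hΨ, hΦ, hl, hr, hc, hh, hc', -, hmem, hfr⟩ := h z hz
  exact ⟨U, V, Ψ, Φ, EuclideanSpace.proj i₀, EuclideanSpace.single i₀ 1,
    ⟨hU, hV, hΨ, hΦ, hl, hr, by exact_mod_cast hc, hh, by exact_mod_cast hc', hmem, hfr⟩,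
    by simp, hzU⟩

theorem SmoothBoundary.uniqueDiffOn_closure (h : SmoothBoundary 4 α Ω) (hΩ : IsOpen Ω) :
    UniqueDiffOn ℝ (closure Ω) := by
  intro x hx
  by_cases hxΩ : x ∈ Ω
  · exact (hΩ.uniqueDiffWithinAt hxΩ).mono subset_closure
  · have hxF : x ∈ frontier Ω := ⟨hx, by rwa [hΩ.interior_eq]⟩
    obtain ⟨U, V, Ψ, Φ, l, ν, hchart, hν, hxU⟩ := h.exists_isBoundaryChart hxF
    exact hchart.uniqueDiffWithinAt_closure hΩ hν hxU hx

theorem UnifElliptic.sum_pos {lam : ℝ} (hell : UnifElliptic a lam Ω) (hlam : 0 < lam)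
    (ha : ∀ i j, ContinuousOn (a i j) (closure Ω)) {x : EuclideanSpace ℝ (Fin n)}
    (hx : x ∈ closure Ω) {φ : EuclideanSpace ℝ (Fin n) →L[ℝ] ℝ} (hφ : φ ≠ 0) :
    0 < ∑ i, ∑ j, a i j x *
      (φ (EuclideanSpace.single i 1) * φ (EuclideanSpace.single j 1)) := by
  set ξ : EuclideanSpace ℝ (Fin n) := WithLp.toLp 2 fun i => φ (EuclideanSpace.single i 1) with hξ
  have hξ0 : ξ ≠ 0 := by
    intro h0
    refine hφ (ContinuousLinearMap.coe_injective
      ((EuclideanSpace.basisFun (Fin n) ℝ).toBasis.ext fun i => ?_))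
    have : ξ i = 0 := by simp [h0]
    simpa [hξ] using this
  have hle : lam * ‖ξ‖ ^ 2 ≤ ∑ i, ∑ j, a i j x * ξ i * ξ j :=
    le_on_closure (f := fun _ => lam * ‖ξ‖ ^ 2) (fun y hy => hell y hy ξ) continuousOn_const
      (continuousOn_finsetSum _ fun i _ => continuousOn_finsetSum _ fun j _ =>
        ((ha i j).mul continuousOn_const).mul continuousOn_const) hx
  have : 0 < lam * ‖ξ‖ ^ 2 := by positivity
  simpa only [hξ, mul_assoc] using this.trans_le hle

set_option maxSynthPendingDepth 3 in
theorem MemDL.sum_fderivWithin_eq_zero (hu : MemDL Ω α a b c u)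
    (hΩ : UniqueDiffOn ℝ (closure Ω)) {x : EuclideanSpace ℝ (Fin n)} (hx : x ∈ frontier Ω) :
    ∑ i, ∑ j, a i j x * fderivWithin ℝ (fderivWithin ℝ u (closure Ω)) (closure Ω) x
        (EuclideanSpace.single i 1) (EuclideanSpace.single j 1) +
      ∑ i, b i x * fderivWithin ℝ u (closure Ω) x (EuclideanSpace.single i 1) = 0 := by
  have hxc : x ∈ closure Ω := frontier_subset_closure hx
  have h := hu.2.2 x hx
  have h2 : ∀ i j, pdW (closure Ω) i (pdW (closure Ω) j u) x =
      fderivWithin ℝ (fderivWithin ℝ u (closure Ω)) (closure Ω) x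
        (EuclideanSpace.single i 1) (EuclideanSpace.single j 1) := by
    intro i j
    have := ((hu.1.1.hasTwoFDerivsOn hΩ).snd x hxc).clm_apply
      (hasFDerivWithinAt_const (EuclideanSpace.single j (1 : ℝ)) x (closure Ω))
    unfold pdW
    rw [this.fderivWithin (hΩ x hxc)]
    simp
  rw [LopW, hu.2.1 x hx, mul_zero, add_zero] at h
  simp only [h2] at h
  exact h

set_option maxSynthPendingDepth 3 in
theorem MemC2α.exists_bound (hu : MemC2α α u (closure Ω)) (hΩ : UniqueDiffOn ℝ (closure Ω))
    (hc : IsCompact (closure Ω)) :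
    ∃ M : ℝ≥0, C2HolderOn α (closure Ω) u (fderivWithin ℝ u (closure Ω))
      (fderivWithin ℝ (fderivWithin ℝ u (closure Ω)) (closure Ω)) M := by
  obtain ⟨hd, C, hC⟩ := hu
  obtain ⟨M₀, h₀⟩ := hc.exists_bound_of_continuousOn hd.continuousOn
  obtain ⟨M₁, h₁⟩ := hc.exists_bound_of_continuousOn
    (hd.continuousOn_fderivWithin hΩ (by norm_num))
  obtain ⟨M₂, h₂⟩ := hc.exists_bound_of_continuousOn (hd.continuousOn_fderivWithin_two hΩ)
  rw [holderOnWith_iteratedFDerivWithin_two hΩ] at hC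
  refine ⟨M₀.toNNReal + M₁.toNNReal + M₂.toNNReal + C, hd.hasTwoFDerivsOn hΩ, fun x hx => ?_,
    fun x hx => ?_, fun x hx => ?_, fun x hx y hy => ?_⟩
  · have := (h₀ x hx).trans M₀.le_coe_toNNReal
    push_cast
    linarith [M₁.toNNReal.2, M₂.toNNReal.2, C.2]
  · have := (h₁ x hx).trans M₁.le_coe_toNNReal
    push_cast
    linarith [M₀.toNNReal.2, M₂.toNNReal.2, C.2]
  · have := (h₂ x hx).trans M₂.le_coe_toNNReal
    push_cast
    linarith [M₀.toNNReal.2, M₁.toNNReal.2, C.2]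
  · have := hC.dist_le hx hy
    rw [dist_eq_norm, dist_eq_norm] at this
    refine this.trans (mul_le_mul_of_nonneg_right ?_ (Real.rpow_nonneg (norm_nonneg _) _))
    exact_mod_cast le_add_self

theorem supNormOn_univ_eq {f : EuclideanSpace ℝ (Fin n) → ℝ} {S : Set (EuclideanSpace ℝ (Fin n))}
    (hne : S.Nonempty) (hS : IsCompact S) (hu : ContinuousOn u S) (heq : EqOn f u S)
    (hf : ∀ C : ℝ, 0 ≤ C → (∀ x ∈ S, |u x| ≤ C) → ∀ x, |f x| ≤ C) :
    supNormOn f univ = supNormOn u S := by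
  have hbdd : BddAbove ((fun x => |u x|) '' S) := (hS.image_of_continuousOn hu.abs).bddAbove
  have hle : ∀ x ∈ S, |u x| ≤ supNormOn u S := fun x hx => le_csSup hbdd (mem_image_of_mem _ hx)
  have hle' : ∀ x, |f x| ≤ supNormOn u S := by
    obtain ⟨x, hx⟩ := hne
    exact hf _ ((abs_nonneg _).trans (hle x hx)) hle
  refine le_antisymm (csSup_le (univ_nonempty.image _) ?_) (csSup_le (hne.image _) ?_)
  · rintro _ ⟨x, -, rfl⟩
    exact hle' x
  · rintro _ ⟨x, hx, rfl⟩
    refine le_csSup ⟨supNormOn u S, ?_⟩ ⟨x, trivial, by simp [heq hx]⟩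
    rintro _ ⟨y, -, rfl⟩
    exact hle' y

open Classical in
set_option maxSynthPendingDepth 3 in
theorem exists_local_extension (hΩ : IsOpen Ω) (hα0 : 0 < α) (hα1 : α ≤ 1)
    (hbdry : SmoothBoundary 4 α Ω) (ha : ∀ i j, MemC2α α (a i j) (closure Ω))
    (hb : ∀ i, MemC2α α (b i) (closure Ω)) {lam : ℝ} (hlam : 0 < lam)
    (hell : UnifElliptic a lam Ω) {z : EuclideanSpace ℝ (Fin n)} (hz : z ∈ closure Ω) :
    ∃ (r : ℝ) (R : EuclideanSpace ℝ (Fin n) → EuclideanSpace ℝ (Fin n)) (K : ℝ),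
      0 < r ∧ r ≤ 1 / 2 ∧ 0 ≤ K ∧ (∀ x ∈ ball z r, x ∉ closure Ω → R x ∈ closure Ω) ∧
      ∀ u ∈ {u | MemDL Ω α a b c u}, ∀ (u' : EuclideanSpace ℝ (Fin n) → _)
        (u'' : EuclideanSpace ℝ (Fin n) → _) (M : ℝ), 0 ≤ M →
        C2HolderOn α (closure Ω) u u' u'' M → ∃ f' f'', C2HolderOn α (ball z r)
          (fun x => if x ∈ closure Ω then u x else -u (R x)) f' f'' (K * M) := by
  have huniq := hbdry.uniqueDiffOn_closure hΩ
  by_cases hzΩ : z ∈ Ω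
  · obtain ⟨r, hr, hrΩ⟩ := Metric.mem_nhds_iff.1 (hΩ.mem_nhds hzΩ)
    have hsub : ball z (min r (1 / 2)) ⊆ closure Ω :=
      (ball_subset_ball (min_le_left _ _)).trans (hrΩ.trans subset_closure)
    refine ⟨min r (1 / 2), id, 1, by positivity, min_le_right _ _, zero_le_one,
      fun x hx hxΩ => absurd (hsub hx) hxΩ, fun u _ u' u'' M _ h => ⟨u', u'', ?_⟩⟩
    rw [one_mul]
    exact (h.mono hsub).congr fun x hx => if_pos (hsub hx)
  · have hzF : z ∈ frontier Ω := ⟨hz, by rwa [hΩ.interior_eq]⟩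
    obtain ⟨U, V, Ψ, Φ, l, ν, hchart, hν, hzU⟩ := hbdry.exists_isBoundaryChart hzF
    obtain ⟨r, R, K, hr, hr2, hK, hR, hext⟩ := hchart.exists_extension hΩ huniq hα0 hα1 hν
      (fun x hx i j => C2HolderAt.of_holderOnWith huniq (ha i j).1 (ha i j).2.choose_spec hx)
      (fun x hx i => C2HolderAt.of_holderOnWith huniq (hb i).1 (hb i).2.choose_spec hx)
      (fun x hx φ hφ => hell.sum_pos hlam (fun i j => (ha i j).1.continuousOn) hx hφ) hzU hzF
    refine ⟨r, R, K, hr, hr2, hK, hR, fun u (hu : MemDL Ω α a b c u) u' u'' M hM h =>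
      hext u u' u'' M hM h hu.2.1 fun x hx => ?_⟩
    have hxc := frontier_subset_closure hx
    have hu2 := hu.1.1.hasTwoFDerivsOn huniq
    rw [h.fst_unique hu2 huniq hxc, h.snd_unique hu2 huniq hxc]
    exact hu.sum_fderivWithin_eq_zero huniq hx

end EuclideanDomain

/-- Theorem 3.9, extension on the whole domain. Let `Ω ⊂ ℝⁿ` be a
bounded domain with `C^{4,α}`-smooth boundary, `L` elliptic with
`a_{ij}, b_i ∈ C^{2,α}(Ω̄)`, `c ∈ C^{0,α}(Ω̄)`. Then
`{u ∈ C^{2,α}(Ω̄) ∣ u = 0, Lu = 0 on ∂Ω}` embeds continuously and linearly into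
`C_c^{2,α}(ℝⁿ)` by an extension operator `E` with `Eu = u` on `Ω̄` and
`‖Eu‖_{C⁰(ℝⁿ)} = ‖u‖_{C⁰(Ω̄)}`. -/
theorem global_extension_operator
    {n : ℕ} (Ω : Set (EuclideanSpace ℝ (Fin n)))
    (hΩne : Ω.Nonempty) (hΩopen : IsOpen Ω) (hΩconn : IsConnected Ω)
    (hΩbdd : Bornology.IsBounded Ω)
    (α : ℝ≥0) (hα0 : 0 < α) (hα1 : α ≤ 1)
    (hbdry : SmoothBoundary 4 α Ω)
    (a : Fin n → Fin n → EuclideanSpace ℝ (Fin n) → ℝ)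
    (b : Fin n → EuclideanSpace ℝ (Fin n) → ℝ)
    (c : EuclideanSpace ℝ (Fin n) → ℝ)
    (ha : ∀ i j, MemC2α α (a i j) (closure Ω))
    (hb : ∀ i, MemC2α α (b i) (closure Ω))
    (hc : MemC0α α c (closure Ω))
    (lam Lam : ℝ) (hlam : 0 < lam)
    (hell : UnifElliptic a lam Ω)
    (hcoeff : CoeffBound a b c Lam (closure Ω)) :
    ∃ E : (EuclideanSpace ℝ (Fin n) → ℝ) → (EuclideanSpace ℝ (Fin n) → ℝ),
    ∃ K : ℝ≥0,
      -- linearity on `D(L)`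
      (∀ u v, MemDL Ω α a b c u → MemDL Ω α a b c v →
        ∀ x, E (u + v) x = E u x + E v x) ∧
      (∀ (r : ℝ) u, MemDL Ω α a b c u → ∀ x, E (r • u) x = r * E u x) ∧
      (∀ u, MemDL Ω α a b c u →
        -- `Eu` extends `u`
        EqOn (E u) u (closure Ω) ∧
        -- `Eu ∈ C_c^{2,α}(ℝⁿ)`
        HasCompactSupport (E u) ∧
        ContDiff ℝ 2 (E u) ∧
        (∃ C : ℝ≥0, HolderWith C α (iteratedFDeriv ℝ 2 (E u))) ∧
        -- the sup-norm is preserved (the embedding is a sup-norm isometry)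
        supNormOn (E u) univ = supNormOn u (closure Ω) ∧
        -- continuity w.r.t. the `C^{2,α}`-norms
        (∀ M : ℝ≥0,
          ((∀ i : ℕ, i ≤ 2 → ∀ x ∈ closure Ω,
              ‖iteratedFDerivWithin ℝ i u (closure Ω) x‖ ≤ (M : ℝ)) ∧
            HolderOnWith M α (iteratedFDerivWithin ℝ 2 u (closure Ω)) (closure Ω)) →
          ((∀ i : ℕ, i ≤ 2 → ∀ x, ‖iteratedFDeriv ℝ i (E u) x‖ ≤ (K * M : ℝ≥0)) ∧
            HolderWith (K * M) α (iteratedFDeriv ℝ 2 (E u))))) := by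
  have hcomp : IsCompact (closure Ω) := hΩbdd.isCompact_closure
  have huniq := hbdry.uniqueDiffOn_closure hΩopen
  obtain ⟨T, K, hT⟩ := exists_global_extension (α := α) (D := {u | MemDL Ω α a b c u}) hcomp hα0 hα1
    fun z hz => exists_local_extension hΩopen hα0 hα1 hbdry ha hb hlam hell hz
  refine ⟨T, K, fun u v _ _ x => by simp, fun r u _ x => by simp, fun u hu => ?_⟩
  obtain ⟨heq, hsupp, hsup, hext⟩ := hT u
  obtain ⟨M₀, hM₀⟩ := hu.1.exists_bound huniq hcomp
  obtain ⟨f', f'', hf⟩ := hext hu _ _ M₀ M₀.2 hM₀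
  have hf : C2HolderOn α univ (T u) f' f'' (K * M₀ : ℝ≥0) := by exact_mod_cast hf
  refine ⟨heq, hsupp, hf.contDiff hα0, ⟨_, hf.holderWith_iteratedFDeriv⟩,
    supNormOn_univ_eq hΩne.closure hcomp hu.1.1.continuousOn heq hsup, fun M hM => ?_⟩
  obtain ⟨g', g'', hg⟩ := hext hu _ _ M M.2 (hu.1.1.c2HolderOn huniq hM.1 hM.2)
  have hg : C2HolderOn α univ (T u) g' g'' (K * M : ℝ≥0) := by exact_mod_cast hg
  exact ⟨fun i hi x => hg.norm_iteratedFDeriv_le hi x, hg.holderWith_iteratedFDeriv⟩
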